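/- arXiv:2005.06573 — 2 statements merged into one kernel-verified Lean document; each statement's English description precedes it below -/
import Mathlib

section
/- Assume each kernel k^j is measurable, bounded and positive semidefinite, and that the product kernel k is characteristic. Let μ be a probability measure on 𝒳 that is not equal to the product of its d marginals (the alternative hypothesis), and let D be an i.i.d. sample of size n from μ. Define the all-permutations p-value p_D = (n!)^{−(d−1)} · #{permutation vectors ψ : dHSIĈ(ψD) ≥ dHSIĈ(D)}. Then p_D → 0 in probability as n → ∞; in particular, for every level α ∈ (0,1), P(p_D ≤ α) → 1, so the permutation test enumerating all permutation vectors is consistent. -/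
open MeasureTheory ProbabilityTheory Filter
open scoped ENNReal Classical

/-- The action of a permutation vector `ψ = (ψ^1, …, ψ^{d-1})` on a dataset:
the first coordinate is kept fixed and coordinate `j+1` is permuted by `ψ^j`. -/
def permAct {d n : ℕ} {𝒳 : Fin d → Type*} (ψ : Fin (d-1) → Equiv.Perm (Fin n))
    (D : Fin n → ∀ j, 𝒳 j) : Fin n → ∀ j, 𝒳 j :=
  fun i j => if h : j.val = 0 then D i j
    else D ((ψ ⟨j.val - 1, by have := j.isLt; omega⟩) i) j

/-- The empirical dHSIC statistic of a dataset `(x_1, …, x_n)`, built from kernels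
`k^1, …, k^d`. -/
noncomputable def dHSIC {d n : ℕ} {𝒳 : Fin d → Type*} (k : ∀ j, 𝒳 j → 𝒳 j → ℝ)
    (x : Fin n → ∀ j, 𝒳 j) : ℝ :=
  (1/(n:ℝ)^2) * ∑ i : Fin n × Fin n, ∏ j, k j (x i.1 j) (x i.2 j)
  + (1/(n:ℝ)^(2*d)) * ∑ i : Fin (2*d) → Fin n, ∏ j : Fin d,
      k j (x (i ⟨2*j.val, by have := j.isLt; omega⟩) j)
          (x (i ⟨2*j.val+1, by have := j.isLt; omega⟩) j)
  - (2/(n:ℝ)^(d+1)) * ∑ i : Fin (d+1) → Fin n, ∏ j : Fin d,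
      k j (x (i 0) j) (x (i j.succ) j)

/-- A kernel is positive semidefinite if it is symmetric and all its Gram matrices are
positive semidefinite. -/
def IsPSDKernel {α : Type*} (k : α → α → ℝ) : Prop :=
  (∀ x y, k x y = k y x) ∧
    ∀ (m : ℕ) (x : Fin m → α) (c : Fin m → ℝ),
      0 ≤ ∑ a : Fin m, ∑ b : Fin m, c a * c b * k (x a) (x b)

/-- A kernel `K` on a measurable space is characteristic if the associated squared
MMD between any two distinct probability measures is strictly positive. -/
def IsCharacteristic {α : Type*} [MeasurableSpace α] (K : α → α → ℝ) : Prop :=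
  ∀ P Q : Measure α, IsProbabilityMeasure P → IsProbabilityMeasure Q → P ≠ Q →
    0 < (∫ x, ∫ y, K x y ∂P ∂P) + (∫ x, ∫ y, K x y ∂Q ∂Q)
        - 2 * ∫ x, ∫ y, K x y ∂P ∂Q

section VStatistics

/-- The V-statistic of the dataset `x` with kernel `h`. -/
noncomputable def vStat {X ι : Type*} [Fintype ι] [DecidableEq ι] {n : ℕ}
    (h : (ι → X) → ℝ) (x : Fin n → X) : ℝ :=
  (1 / (n : ℝ) ^ Fintype.card ι) * ∑ i : ι → Fin n, h (fun a => x (i a))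

lemma abs_vStat_le {X ι : Type*} [Fintype ι] [DecidableEq ι] {n : ℕ} (hn : n ≠ 0) {M : ℝ}
    {h : (ι → X) → ℝ} (hM : ∀ y, |h y| ≤ M) (x : Fin n → X) : |vStat h x| ≤ M := by
  have hpos : (0 : ℝ) < (n : ℝ) ^ Fintype.card ι := by positivity
  rw [vStat, abs_mul, abs_of_pos (by positivity), one_div, inv_mul_le_iff₀ hpos]
  refine (Finset.abs_sum_le_sum_abs _ _).trans ((Finset.sum_le_card_nsmul _ _ M
    fun i _ => hM _).trans ?_)
  simp

lemma vStat_sq {X ι : Type*} [Fintype ι] [DecidableEq ι] {n : ℕ} (h : (ι → X) → ℝ)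
    (x : Fin n → X) :
    vStat h x ^ 2 = vStat (fun y : ι ⊕ ι → X =>
      h (fun a => y (Sum.inl a)) * h (fun a => y (Sum.inr a))) x := by
  simp only [vStat]
  rw [← (Equiv.sumArrowEquivProdArrow ι ι (Fin n)).symm.sum_comp, Fintype.sum_prod_type]
  simp only [Fintype.card_sum, pow_add, sq, Equiv.sumArrowEquivProdArrow]
  simp only [Equiv.coe_fn_symm_mk, Sum.elim_inl, Sum.elim_inr]
  rw [← Finset.sum_mul_sum]
  field_simp

lemma integrable_of_measurable_of_bound {Y : Type*} [MeasurableSpace Y] {ν : Measure Y}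
    [IsFiniteMeasure ν] {f : Y → ℝ} (hf : Measurable f) {M : ℝ} (hM : ∀ y, |f y| ≤ M) :
    Integrable f ν :=
  Integrable.of_bound hf.aestronglyMeasurable M (Eventually.of_forall fun y => hM y)

lemma abs_integral_le_of_bound {Y : Type*} [MeasurableSpace Y] {ν : Measure Y}
    [IsProbabilityMeasure ν] {f : Y → ℝ} {M : ℝ} (hM : ∀ y, |f y| ≤ M) :
    |∫ y, f y ∂ν| ≤ M := by
  simpa using norm_integral_le_of_norm_le_const (μ := ν) (f := f) (C := M)
    (Eventually.of_forall fun y => hM y)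

lemma measurable_reindex {X ι κ : Type*} [MeasurableSpace X] (f : κ → ι) :
    Measurable (fun (y : ι → X) a => y (f a)) :=
  measurable_pi_lambda _ fun a => measurable_pi_apply (f a)

variable {X ι κ : Type*} [MeasurableSpace X] [Fintype ι] [Fintype κ]

/-- Selecting distinct coordinates of an i.i.d. family gives an i.i.d. family. -/
lemma map_reindex_pi (μ : Measure X) [IsProbabilityMeasure μ] {f : κ → ι}
    (hf : Function.Injective f) :
    (Measure.pi fun _ : ι => μ).map (fun y a => y (f a)) = Measure.pi fun _ : κ => μ := by
  have h : iIndepFun (fun (i : ι) (ω : ι → X) => ω i) (Measure.pi fun _ : ι => μ) :=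
    iIndepFun_pi (X := fun _ x => x) fun _ => aemeasurable_id
  have h' := h.precomp hf
  rw [iIndepFun_iff_map_fun_eq_pi_map
    (fun i => (measurable_pi_apply (f i)).aemeasurable)] at h'
  rw [h']
  congr 1
  ext1 a
  exact (measurePreserving_eval (fun _ : ι => μ) (f a)).map_eq

lemma integral_reindex_pi (μ : Measure X) [IsProbabilityMeasure μ] {f : κ → ι}
    (hf : Function.Injective f) {h : (κ → X) → ℝ} (hh : Measurable h) :
    ∫ y, h (fun a => y (f a)) ∂(Measure.pi fun _ : ι => μ)
      = ∫ y, h y ∂(Measure.pi fun _ : κ => μ) := by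
  rw [← map_reindex_pi μ hf, integral_map (measurable_reindex f).aemeasurable
    hh.aestronglyMeasurable]

lemma map_reindex_prod_pi (μ : Measure X) [IsProbabilityMeasure μ] {τ : Type*} [Fintype τ]
    {f : κ → ι} {g : τ → ι} (hfg : Function.Injective (Sum.elim f g)) :
    (Measure.pi fun _ : ι => μ).map (fun y => ((fun a => y (f a)), fun b => y (g b)))
      = (Measure.pi fun _ : κ => μ).prod (Measure.pi fun _ : τ => μ) := by
  rw [← (measurePreserving_sumPiEquivProdPi (fun _ : κ ⊕ τ => μ)).map_eq,
    ← map_reindex_pi μ hfg, Measure.map_map (MeasurableEquiv.measurable _) (measurable_reindex _)]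
  rfl

lemma measurable_vStat [DecidableEq ι] {n : ℕ} {h : (ι → X) → ℝ} (hh : Measurable h) :
    Measurable (fun x : Fin n → X => vStat h x) := by
  unfold vStat
  exact (Finset.measurable_sum _ fun i _ => hh.comp (measurable_reindex i)).const_mul _

lemma tendsto_card_not_injective (ι : Type*) [Fintype ι] [DecidableEq ι] :
    Tendsto (fun n : ℕ => ((Finset.univ.filter
      fun i : ι → Fin n => ¬ Function.Injective i).card : ℝ) / (n : ℝ) ^ Fintype.card ι)
      atTop (nhds 0) := by
  have h1 := (Asymptotics.isEquivalent_iff_tendsto_one (by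
    filter_upwards [eventually_gt_atTop 0] with n hn
    positivity)).1 (isEquivalent_descFactorial (Fintype.card ι))
  have h2 := h1.const_sub 1
  rw [sub_self] at h2
  refine h2.congr' ?_
  filter_upwards [eventually_gt_atTop 0] with n hn
  have hinj : (Finset.univ.filter fun i : ι → Fin n => Function.Injective i).card
      = n.descFactorial (Fintype.card ι) := by
    rw [← Fintype.card_subtype, Fintype.card_congr (Equiv.subtypeInjectiveEquivEmbedding ι (Fin n)),
      Fintype.card_embedding_eq, Fintype.card_fin]
  have htot := Finset.card_filter_add_card_filter_not (s := (Finset.univ : Finset (ι → Fin n)))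
    (fun i : ι → Fin n => Function.Injective i)
  rw [hinj, Finset.card_univ, Fintype.card_fun, Fintype.card_fin] at htot
  have htot' : (n.descFactorial (Fintype.card ι) : ℝ) + ((Finset.univ.filter
      fun i : ι → Fin n => ¬ Function.Injective i).card : ℝ) = (n : ℝ) ^ Fintype.card ι := by
    exact_mod_cast htot
  have hpos : (0 : ℝ) < (n : ℝ) ^ Fintype.card ι := by positivity
  simp only [Pi.div_apply]
  rw [eq_div_iff hpos.ne', sub_mul, div_mul_cancel₀ _ hpos.ne']
  linarith

/-- V-statistics with bounded kernels are asymptotically unbiased. -/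
lemma tendsto_integral_vStat [DecidableEq ι] (μ : Measure X) [IsProbabilityMeasure μ]
    {h : (ι → X) → ℝ} (hh : Measurable h) {M : ℝ} (hM : ∀ y, |h y| ≤ M) :
    Tendsto (fun n : ℕ => ∫ x, vStat h x ∂(Measure.pi fun _ : Fin n => μ)) atTop
      (nhds (∫ y, h y ∂(Measure.pi fun _ : ι => μ))) := by
  set θ := ∫ y, h y ∂(Measure.pi fun _ : ι => μ) with hθ
  rw [tendsto_iff_norm_sub_tendsto_zero]
  have hlim := (tendsto_card_not_injective ι).const_mul (2 * M)
  rw [mul_zero] at hlim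
  refine squeeze_zero' (Eventually.of_forall fun _ => norm_nonneg _) ?_ hlim
  filter_upwards [eventually_gt_atTop 0] with n hn
  have hpos : (0 : ℝ) < (n : ℝ) ^ Fintype.card ι := by positivity
  have hsum : ∫ x, vStat h x ∂(Measure.pi fun _ : Fin n => μ) - θ
      = (1 / (n : ℝ) ^ Fintype.card ι) * ∑ i : ι → Fin n,
        (∫ x, h (fun a => x (i a)) ∂(Measure.pi fun _ : Fin n => μ) - θ) := by
    simp only [vStat]
    have hvint : ∀ i : ι → Fin n, Integrable (fun x : Fin n → X => h (fun a => x (i a)))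
        (Measure.pi fun _ : Fin n => μ) := fun i =>
      integrable_of_measurable_of_bound (hh.comp (measurable_reindex i)) (fun y => hM _)
    rw [integral_const_mul, integral_finsetSum _ fun i _ => hvint i, Finset.sum_sub_distrib]
    simp only [Finset.sum_const, Finset.card_univ, Fintype.card_fun, Fintype.card_fin,
      nsmul_eq_mul, Nat.cast_pow]
    field_simp
  rw [hsum, Real.norm_eq_abs, abs_mul, abs_of_pos (by positivity), mul_div_assoc', one_div,
    inv_mul_le_iff₀ hpos, mul_div_cancel₀ _ hpos.ne', mul_comm, ← nsmul_eq_mul,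
    ← Finset.sum_const, Finset.sum_filter]
  refine (Finset.abs_sum_le_sum_abs _ _).trans (Finset.sum_le_sum fun i _ => ?_)
  by_cases hi : Function.Injective i
  · rw [integral_reindex_pi μ hi hh]
    simp [hi, hθ]
  · rw [if_pos hi]
    have h1 := abs_integral_le_of_bound (ν := Measure.pi fun _ : Fin n => μ)
      (f := fun x => h (fun a => x (i a))) (fun y => hM _)
    have h2 : |θ| ≤ M := abs_integral_le_of_bound hM
    exact (abs_sub _ _).trans (by linarith)

/-- The weak law of large numbers for V-statistics with bounded kernels. -/
lemma tendsto_measure_vStat [DecidableEq ι] (μ : Measure X) [IsProbabilityMeasure μ]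
    {h : (ι → X) → ℝ} (hh : Measurable h) {M : ℝ} (hM : ∀ y, |h y| ≤ M) {δ : ℝ} (hδ : 0 < δ) :
    Tendsto (fun n : ℕ => (Measure.pi fun _ : Fin n => μ)
      {x | δ ≤ |vStat h x - ∫ y, h y ∂(Measure.pi fun _ : ι => μ)|}) atTop (nhds 0) := by
  set θ := ∫ y, h y ∂(Measure.pi fun _ : ι => μ) with hθ
  set g : (ι ⊕ ι → X) → ℝ := fun y =>
    h (fun a => y (Sum.inl a)) * h (fun a => y (Sum.inr a)) with hg
  have hgm : Measurable g :=
    (hh.comp (measurable_reindex _)).mul (hh.comp (measurable_reindex _))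
  have hgM : ∀ y, |g y| ≤ M * M := fun y => by
    rw [hg, abs_mul]
    exact mul_le_mul (hM _) (hM _) (abs_nonneg _)
      ((abs_nonneg _).trans (hM (fun a => y (Sum.inl a))))
  have hgint : ∫ y, g y ∂(Measure.pi fun _ : ι ⊕ ι => μ) = θ ^ 2 := by
    have hmp := measurePreserving_sumPiEquivProdPi (fun _ : ι ⊕ ι => μ)
    have := hmp.integral_comp' (fun p : (ι → X) × (ι → X) => h p.1 * h p.2)
    rw [integral_prod_mul] at this
    rw [sq, hθ, ← this]
    rfl
  have hlim : Tendsto (fun n : ℕ => ∫ x, (vStat h x - θ) ^ 2 ∂(Measure.pi fun _ : Fin n => μ))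
      atTop (nhds 0) := by
    have h1 := tendsto_integral_vStat μ hgm hgM
    rw [hgint] at h1
    have h2 := ((h1.sub ((tendsto_integral_vStat μ hh hM).const_mul (2 * θ))).add_const (θ ^ 2))
    rw [← hθ, show θ ^ 2 - 2 * θ * θ + θ ^ 2 = 0 by ring] at h2
    refine h2.congr' ?_
    filter_upwards [eventually_gt_atTop 0] with n hn
    have i1 : Integrable (fun x => vStat g x) (Measure.pi fun _ : Fin n => μ) :=
      integrable_of_measurable_of_bound (measurable_vStat hgm) (abs_vStat_le hn.ne' hgM)
    have i2 : Integrable (fun x => vStat h x) (Measure.pi fun _ : Fin n => μ) :=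
      integrable_of_measurable_of_bound (measurable_vStat hh) (abs_vStat_le hn.ne' hM)
    have : (fun x : Fin n → X => (vStat h x - θ) ^ 2)
        = fun x => vStat g x - 2 * θ * vStat h x + θ ^ 2 := by
      ext x
      rw [hg, ← vStat_sq]
      ring
    have i3 : Integrable (fun x => vStat g x - 2 * θ * vStat h x)
      (Measure.pi fun _ : Fin n => μ) := i1.sub (i2.const_mul _)
    rw [this, integral_add i3 (integrable_const _), integral_sub i1 (i2.const_mul _),
      integral_const_mul]
    simp
  have hlim' : Tendsto (fun n : ℕ => ENNReal.ofReal
      ((∫ x, (vStat h x - θ) ^ 2 ∂(Measure.pi fun _ : Fin n => μ)) / δ ^ 2)) atTop (nhds 0) := by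
    simpa using ENNReal.tendsto_ofReal (hlim.div_const (δ ^ 2))
  refine tendsto_of_tendsto_of_tendsto_of_le_of_le' tendsto_const_nhds hlim'
    (Eventually.of_forall fun _ => zero_le) ?_
  filter_upwards [eventually_gt_atTop 0] with n hn
  have hvint : Integrable (fun x => (vStat h x - θ) ^ 2) (Measure.pi fun _ : Fin n => μ) := by
    refine integrable_of_measurable_of_bound (M := (M + |θ|) ^ 2)
      (((measurable_vStat hh).sub_const θ).pow_const 2) fun x => ?_
    rw [abs_pow]
    exact pow_le_pow_left₀ (abs_nonneg _)
      ((abs_sub _ _).trans (by linarith [abs_vStat_le hn.ne' hM x])) 2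
  have hmarkov := mul_meas_ge_le_integral_of_nonneg
    (Eventually.of_forall fun x => sq_nonneg (vStat h x - θ)) hvint (δ ^ 2)
  have hset : {x : Fin n → X | δ ≤ |vStat h x - θ|} = {x | δ ^ 2 ≤ (vStat h x - θ) ^ 2} := by
    ext x
    simp only [Set.mem_ofPred_eq]
    rw [← sq_abs (vStat h x - θ), sq_le_sq₀ hδ.le (abs_nonneg _)]
  rw [hset, ← ofReal_measureReal]
  refine ENNReal.ofReal_le_ofReal ?_
  rw [le_div_iff₀ (by positivity)]
  linarith

end VStatistics

section PopulationDHSIC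

variable {d : ℕ} {𝒳 : Fin d → Type*}

/-- The V-statistic kernel of the first term of dHSIC. -/
def jointKernel (k : ∀ j, 𝒳 j → 𝒳 j → ℝ) (y : Fin 2 → ∀ j, 𝒳 j) : ℝ :=
  ∏ j, k j (y 0 j) (y 1 j)

/-- The V-statistic kernel of the second term of dHSIC. -/
def marginalKernel (k : ∀ j, 𝒳 j → 𝒳 j → ℝ) (y : Fin (2 * d) → ∀ j, 𝒳 j) : ℝ :=
  ∏ j : Fin d, k j (y ⟨2 * j.val, by have := j.isLt; omega⟩ j)
    (y ⟨2 * j.val + 1, by have := j.isLt; omega⟩ j)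

/-- The V-statistic kernel of the third term of dHSIC. -/
def crossKernel (k : ∀ j, 𝒳 j → 𝒳 j → ℝ) (y : Fin (d + 1) → ∀ j, 𝒳 j) : ℝ :=
  ∏ j : Fin d, k j (y 0 j) (y j.succ j)

lemma dHSIC_eq_vStat {n : ℕ} (k : ∀ j, 𝒳 j → 𝒳 j → ℝ) (x : Fin n → ∀ j, 𝒳 j) :
    dHSIC k x = vStat (jointKernel k) x + vStat (marginalKernel k) x
      - 2 * vStat (crossKernel k) x := by
  simp only [dHSIC, vStat, jointKernel, marginalKernel, crossKernel, Fintype.card_fin]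
  rw [← (finTwoArrowEquiv (Fin n)).sum_comp]
  simp only [finTwoArrowEquiv, piFinTwoEquiv, Equiv.coe_fn_mk]
  ring

lemma abs_prod_kernel_le {k : ∀ j, 𝒳 j → 𝒳 j → ℝ} {C : ℝ} (hC : ∀ j x y, |k j x y| ≤ C)
    (u v : ∀ j, 𝒳 j) : |∏ j, k j (u j) (v j)| ≤ C ^ d := by
  rw [Finset.abs_prod]
  refine (Finset.prod_le_prod (fun _ _ => abs_nonneg _) fun j _ => hC j _ _).trans ?_
  simp

lemma abs_jointKernel_le {k : ∀ j, 𝒳 j → 𝒳 j → ℝ} {C : ℝ} (hC : ∀ j x y, |k j x y| ≤ C)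
    (y : Fin 2 → ∀ j, 𝒳 j) : |jointKernel k y| ≤ C ^ d :=
  abs_prod_kernel_le hC _ _

lemma abs_marginalKernel_le {k : ∀ j, 𝒳 j → 𝒳 j → ℝ} {C : ℝ} (hC : ∀ j x y, |k j x y| ≤ C)
    (y : Fin (2 * d) → ∀ j, 𝒳 j) : |marginalKernel k y| ≤ C ^ d :=
  abs_prod_kernel_le hC (fun j => y ⟨2 * j.val, by have := j.isLt; omega⟩ j)
    fun j => y ⟨2 * j.val + 1, by have := j.isLt; omega⟩ j

lemma abs_crossKernel_le {k : ∀ j, 𝒳 j → 𝒳 j → ℝ} {C : ℝ} (hC : ∀ j x y, |k j x y| ≤ C)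
    (y : Fin (d + 1) → ∀ j, 𝒳 j) : |crossKernel k y| ≤ C ^ d :=
  abs_prod_kernel_le hC (y 0) fun j => y j.succ j

variable [∀ j, MeasurableSpace (𝒳 j)]

lemma measurable_prod_kernel {k : ∀ j, 𝒳 j → 𝒳 j → ℝ}
    (hk : ∀ j, Measurable (fun p : 𝒳 j × 𝒳 j => k j p.1 p.2)) :
    Measurable (fun p : (∀ j, 𝒳 j) × (∀ j, 𝒳 j) => ∏ j, k j (p.1 j) (p.2 j)) :=
  Finset.measurable_prod _ fun j _ => (hk j).comp
    (((measurable_pi_apply j).comp measurable_fst).prodMk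
      ((measurable_pi_apply j).comp measurable_snd))

lemma measurable_eval_eval {ι : Type*} (i : ι) (j : Fin d) :
    Measurable (fun y : ι → ∀ j, 𝒳 j => y i j) :=
  (measurable_pi_apply j).comp (measurable_pi_apply i)

lemma measurable_jointKernel {k : ∀ j, 𝒳 j → 𝒳 j → ℝ}
    (hk : ∀ j, Measurable (fun p : 𝒳 j × 𝒳 j => k j p.1 p.2)) : Measurable (jointKernel k) :=
  Finset.measurable_prod _ fun j _ => (hk j).comp
    ((measurable_eval_eval _ j).prodMk (measurable_eval_eval _ j))

lemma measurable_marginalKernel {k : ∀ j, 𝒳 j → 𝒳 j → ℝ}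
    (hk : ∀ j, Measurable (fun p : 𝒳 j × 𝒳 j => k j p.1 p.2)) : Measurable (marginalKernel k) :=
  Finset.measurable_prod _ fun j _ => (hk j).comp
    ((measurable_eval_eval _ j).prodMk (measurable_eval_eval _ j))

lemma measurable_crossKernel {k : ∀ j, 𝒳 j → 𝒳 j → ℝ}
    (hk : ∀ j, Measurable (fun p : 𝒳 j × 𝒳 j => k j p.1 p.2)) : Measurable (crossKernel k) :=
  Finset.measurable_prod _ fun j _ => (hk j).comp
    ((measurable_eval_eval _ j).prodMk (measurable_eval_eval _ j))

/-- The population dHSIC of a distribution `P`. -/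
noncomputable def populationDHSIC (k : ∀ j, 𝒳 j → 𝒳 j → ℝ) (P : Measure (∀ j, 𝒳 j)) : ℝ :=
  (∫ y, jointKernel k y ∂(Measure.pi fun _ : Fin 2 => P))
    + (∫ y, marginalKernel k y ∂(Measure.pi fun _ : Fin (2 * d) => P))
    - 2 * ∫ y, crossKernel k y ∂(Measure.pi fun _ : Fin (d + 1) => P)

lemma pi_marginals_eq_map (P : Measure (∀ j, 𝒳 j)) [IsProbabilityMeasure P] :
    (Measure.pi fun j => P.map (fun x => x j))
      = (Measure.pi fun _ : Fin d => P).map (fun y j => y j j) := by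
  have hp : ∀ j, IsProbabilityMeasure (P.map (fun x : ∀ j, 𝒳 j => x j)) := fun j =>
    Measure.isProbabilityMeasure_map (measurable_pi_apply j).aemeasurable
  exact (Measure.pi_map_pi (μ := fun _ : Fin d => P) (f := fun j (x : ∀ j, 𝒳 j) => x j)
    fun j => (measurable_pi_apply j).aemeasurable).symm

/-- The population dHSIC is the squared MMD between `P` and the product of its marginals. -/
lemma populationDHSIC_eq_mmd {k : ∀ j, 𝒳 j → 𝒳 j → ℝ}
    (hk : ∀ j, Measurable (fun p : 𝒳 j × 𝒳 j => k j p.1 p.2))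
    {C : ℝ} (hC : ∀ j x y, |k j x y| ≤ C) (hsymm : ∀ j x y, k j x y = k j y x)
    (P : Measure (∀ j, 𝒳 j)) [IsProbabilityMeasure P] :
    populationDHSIC k P
      = (∫ x, ∫ y, ∏ j, k j (x j) (y j) ∂P ∂P)
        + (∫ x, ∫ y, ∏ j, k j (x j) (y j) ∂(Measure.pi fun j => P.map (fun x => x j))
            ∂(Measure.pi fun j => P.map (fun x => x j)))
        - 2 * ∫ x, ∫ y, ∏ j, k j (x j) (y j) ∂P ∂(Measure.pi fun j => P.map (fun x => x j)) := by
  have hK := measurable_prod_kernel hk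
  have hdiag : Measurable (fun (y : Fin d → ∀ j, 𝒳 j) j => y j j) :=
    measurable_pi_lambda _ fun j => measurable_eval_eval j j
  rw [pi_marginals_eq_map]
  have hQ : IsProbabilityMeasure
      ((Measure.pi fun _ : Fin d => P).map (fun (y : Fin d → ∀ j, 𝒳 j) j => y j j)) :=
    Measure.isProbabilityMeasure_map hdiag.aemeasurable
  have hKint : ∀ (ν ρ : Measure (∀ j, 𝒳 j)) [IsProbabilityMeasure ν] [IsProbabilityMeasure ρ],
      (∫ x, ∫ y, ∏ j, k j (x j) (y j) ∂ρ ∂ν)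
        = ∫ p, ∏ j, k j (p.1 j) (p.2 j) ∂(ν.prod ρ) := fun ν ρ _ _ =>
    (integral_prod (fun p : (∀ j, 𝒳 j) × (∀ j, 𝒳 j) => ∏ j, k j (p.1 j) (p.2 j))
      (integrable_of_measurable_of_bound hK fun p => abs_prod_kernel_le hC p.1 p.2)).symm
  rw [hKint, hKint, hKint]
  have h1 : ∫ y, jointKernel k y ∂(Measure.pi fun _ : Fin 2 => P)
      = ∫ p, ∏ j, k j (p.1 j) (p.2 j) ∂(P.prod P) :=
    (measurePreserving_finTwoArrow P).integral_comp'
      (fun p : (∀ j, 𝒳 j) × (∀ j, 𝒳 j) => ∏ j, k j (p.1 j) (p.2 j))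
  have h2 : ∫ y, marginalKernel k y ∂(Measure.pi fun _ : Fin (2 * d) => P)
      = ∫ p, ∏ j, k j (p.1 j) (p.2 j)
        ∂(((Measure.pi fun _ : Fin d => P).map (fun y j => y j j)).prod
          ((Measure.pi fun _ : Fin d => P).map (fun y j => y j j))) := by
    rw [Measure.map_prod_map _ _ hdiag hdiag,
      integral_map (hdiag.prodMap hdiag).aemeasurable hK.aestronglyMeasurable]
    have hinj : Function.Injective (Sum.elim
        (fun j : Fin d => (⟨2 * j.val, by have := j.isLt; omega⟩ : Fin (2 * d)))
        (fun j : Fin d => (⟨2 * j.val + 1, by have := j.isLt; omega⟩ : Fin (2 * d)))) := by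
      rintro (a | a) (b | b) hab <;>
        simp only [Sum.elim_inl, Sum.elim_inr, reduceCtorEq, Sum.inl.injEq,
          Sum.inr.injEq, Fin.ext_iff] at hab ⊢ <;> omega
    rw [← map_reindex_prod_pi P hinj, integral_map
      ((measurable_reindex _).prodMk (measurable_reindex _)).aemeasurable
      (by exact (hK.comp (hdiag.prodMap hdiag)).aestronglyMeasurable)]
    rfl
  have h3 : ∫ y, crossKernel k y ∂(Measure.pi fun _ : Fin (d + 1) => P)
      = ∫ p, ∏ j, k j (p.1 j) (p.2 j)
        ∂(((Measure.pi fun _ : Fin d => P).map (fun y j => y j j)).prod P) := by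
    rw [← integral_prod_swap]
    nth_rw 2 [← Measure.map_id (μ := P)]
    rw [Measure.map_prod_map _ _ measurable_id hdiag,
      integral_map (measurable_id.prodMap hdiag).aemeasurable
        (by exact (hK.comp measurable_swap).aestronglyMeasurable),
      ← (measurePreserving_piFinSuccAbove (fun _ : Fin (d + 1) => P) 0).integral_comp']
    refine integral_congr_ae (Eventually.of_forall fun y => ?_)
    exact Finset.prod_congr rfl fun j _ => hsymm j _ _
  rw [populationDHSIC, h1, h2, h3]

lemma populationDHSIC_pos {k : ∀ j, 𝒳 j → 𝒳 j → ℝ}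
    (hk : ∀ j, Measurable (fun p : 𝒳 j × 𝒳 j => k j p.1 p.2))
    {C : ℝ} (hC : ∀ j x y, |k j x y| ≤ C) (hsymm : ∀ j x y, k j x y = k j y x)
    (hchar : IsCharacteristic (fun x y : ∀ j, 𝒳 j => ∏ j, k j (x j) (y j)))
    (P : Measure (∀ j, 𝒳 j)) [IsProbabilityMeasure P]
    (hP : P ≠ Measure.pi (fun j => P.map (fun x => x j))) : 0 < populationDHSIC k P := by
  rw [populationDHSIC_eq_mmd hk hC hsymm]
  have hp : ∀ j, IsProbabilityMeasure (P.map (fun x : ∀ j, 𝒳 j => x j)) := fun j =>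
    Measure.isProbabilityMeasure_map (measurable_pi_apply j).aemeasurable
  exact hchar P _ inferInstance inferInstance hP

lemma populationDHSIC_nonneg {k : ∀ j, 𝒳 j → 𝒳 j → ℝ}
    (hk : ∀ j, Measurable (fun p : 𝒳 j × 𝒳 j => k j p.1 p.2))
    {C : ℝ} (hC : ∀ j x y, |k j x y| ≤ C) (hsymm : ∀ j x y, k j x y = k j y x)
    (hchar : IsCharacteristic (fun x y : ∀ j, 𝒳 j => ∏ j, k j (x j) (y j)))
    (P : Measure (∀ j, 𝒳 j)) [IsProbabilityMeasure P] : 0 ≤ populationDHSIC k P := by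
  by_cases hP : P = Measure.pi (fun j => P.map (fun x => x j))
  · rw [populationDHSIC_eq_mmd hk hC hsymm, ← hP]
    linarith
  · exact (populationDHSIC_pos hk hC hsymm hchar P hP).le

/-- A V-statistic is an integral against a power of the empirical measure. -/
lemma integral_empirical {X ι : Type*} [MeasurableSpace X] [Fintype ι] [DecidableEq ι] {n : ℕ}
    [NeZero n] {h : (ι → X) → ℝ} (hh : Measurable h) (x : Fin n → X) :
    ∫ y, h y ∂(Measure.pi fun _ : ι => (PMF.uniformOfFintype (Fin n)).toMeasure.map x)
      = vStat h x := by
  have hx : Measurable x := measurable_of_countable x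
  have hp : IsProbabilityMeasure ((PMF.uniformOfFintype (Fin n)).toMeasure.map x) :=
    Measure.isProbabilityMeasure_map hx.aemeasurable
  rw [← Measure.pi_map_pi (μ := fun _ : ι => (PMF.uniformOfFintype (Fin n)).toMeasure)
      (f := fun _ => x) (fun _ => hx.aemeasurable),
    integral_map (measurable_of_countable _).aemeasurable hh.aestronglyMeasurable,
    integral_fintype .of_finite, vStat, Finset.mul_sum]
  refine Finset.sum_congr rfl fun i _ => ?_
  simp [Measure.real, Measure.pi_singleton]

lemma dHSIC_nonneg {n : ℕ} [NeZero n] {k : ∀ j, 𝒳 j → 𝒳 j → ℝ}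
    (hk : ∀ j, Measurable (fun p : 𝒳 j × 𝒳 j => k j p.1 p.2))
    {C : ℝ} (hC : ∀ j x y, |k j x y| ≤ C) (hsymm : ∀ j x y, k j x y = k j y x)
    (hchar : IsCharacteristic (fun x y : ∀ j, 𝒳 j => ∏ j, k j (x j) (y j)))
    (x : Fin n → ∀ j, 𝒳 j) : 0 ≤ dHSIC k x := by
  have hp : IsProbabilityMeasure ((PMF.uniformOfFintype (Fin n)).toMeasure.map x) :=
    Measure.isProbabilityMeasure_map (measurable_of_countable x).aemeasurable
  rw [dHSIC_eq_vStat, ← integral_empirical (measurable_jointKernel hk),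
    ← integral_empirical (measurable_marginalKernel hk),
    ← integral_empirical (measurable_crossKernel hk)]
  exact populationDHSIC_nonneg hk hC hsymm hchar _

/-- The empirical dHSIC stays away from `0` with high probability if the population dHSIC is
positive. -/
lemma tendsto_measure_dHSIC_le {k : ∀ j, 𝒳 j → 𝒳 j → ℝ}
    (hk : ∀ j, Measurable (fun p : 𝒳 j × 𝒳 j => k j p.1 p.2))
    {C : ℝ} (hC : ∀ j x y, |k j x y| ≤ C)
    (μ : Measure (∀ j, 𝒳 j)) [IsProbabilityMeasure μ] (hpos : 0 < populationDHSIC k μ) :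
    Tendsto (fun n : ℕ => (Measure.pi fun _ : Fin n => μ)
      {D | dHSIC k D ≤ populationDHSIC k μ / 2}) atTop (nhds 0) := by
  have hδ : 0 < populationDHSIC k μ / 8 := by positivity
  have hlim := ((tendsto_measure_vStat μ (measurable_jointKernel hk) (abs_jointKernel_le hC)
    hδ).add (tendsto_measure_vStat μ (measurable_marginalKernel hk) (abs_marginalKernel_le hC)
    hδ)).add (tendsto_measure_vStat μ (measurable_crossKernel hk) (abs_crossKernel_le hC) hδ)
  rw [add_zero, add_zero] at hlim
  refine tendsto_of_tendsto_of_tendsto_of_le_of_le tendsto_const_nhds hlim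
    (fun _ => zero_le) fun n => ?_
  refine (measure_mono ?_).trans ((measure_union_le _ _).trans
    (add_le_add_left (measure_union_le _ _) _))
  intro D hD
  by_contra hnot
  simp only [Set.mem_union, Set.mem_ofPred_eq, not_or, not_le, abs_lt] at hnot hD
  obtain ⟨⟨h1, h2⟩, h3⟩ := hnot
  have hdef : populationDHSIC k μ = (∫ y, jointKernel k y ∂(Measure.pi fun _ : Fin 2 => μ))
    + (∫ y, marginalKernel k y ∂(Measure.pi fun _ : Fin (2 * d) => μ))
    - 2 * ∫ y, crossKernel k y ∂(Measure.pi fun _ : Fin (d + 1) => μ) := rfl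
  rw [dHSIC_eq_vStat] at hD
  linarith [h1.1, h2.1, h3.2]

end PopulationDHSIC

section PermutationMean

lemma abs_prod_le_pow_card {ι : Type*} (s : Finset ι) {a : ι → ℝ} {C : ℝ} (ha : ∀ i, |a i| ≤ C) :
    |∏ i ∈ s, a i| ≤ C ^ s.card := by
  rw [Finset.abs_prod, ← Finset.prod_const]
  exact Finset.prod_le_prod (fun _ _ => abs_nonneg _) fun i _ => ha i

lemma abs_prod_sub_prod_le {ι : Type*} (s : Finset ι) {a b : ι → ℝ} {C δ : ℝ} (hC : 1 ≤ C)
    (ha : ∀ i, |a i| ≤ C) (hb : ∀ i, |b i| ≤ C) (hab : ∀ i, |a i - b i| ≤ δ) :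
    |∏ i ∈ s, a i - ∏ i ∈ s, b i| ≤ s.card * C ^ s.card * δ := by
  induction s using Finset.induction_on with
  | empty => simp
  | insert i s hi ih =>
    have hδ : 0 ≤ δ := (abs_nonneg _).trans (hab i)
    have hP : |∏ i ∈ s, b i| ≤ C ^ s.card := abs_prod_le_pow_card s hb
    have hpow : C ^ s.card ≤ C ^ (s.card + 1) := pow_le_pow_right₀ hC (Nat.le_succ _)
    rw [Finset.prod_insert hi, Finset.prod_insert hi, Finset.card_insert_of_notMem hi,
      show a i * ∏ x ∈ s, a x - b i * ∏ x ∈ s, b x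
        = a i * (∏ x ∈ s, a x - ∏ x ∈ s, b x) + (a i - b i) * ∏ x ∈ s, b x by ring]
    calc _ ≤ |a i| * |∏ x ∈ s, a x - ∏ x ∈ s, b x| + |a i - b i| * |∏ x ∈ s, b x| := by
          rw [← abs_mul, ← abs_mul]
          exact abs_add_le _ _
      _ ≤ C * (s.card * C ^ s.card * δ) + δ * C ^ (s.card + 1) := by
          gcongr
          · exact ha i
          · exact hab i
          · exact hP.trans hpow
      _ = _ := by
          push_cast
          ring

variable {n : ℕ}

lemma abs_mean_le {ι : Type*} [Fintype ι] [Nonempty ι] {f : ι → ℝ} {C : ℝ} (hf : ∀ i, |f i| ≤ C) :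
    |(1 / (Fintype.card ι : ℝ)) * ∑ i, f i| ≤ C := by
  have hpos : (0 : ℝ) < Fintype.card ι := by exact_mod_cast Fintype.card_pos
  rw [abs_mul, abs_of_pos (by positivity), one_div, inv_mul_le_iff₀ hpos, ← nsmul_eq_mul]
  exact (Finset.abs_sum_le_sum_abs _ _).trans (Finset.sum_le_card_nsmul _ _ C fun i _ => hf i)

/-- The mean of `g` at `(σ a, σ b)` over all permutations `σ`. -/
noncomputable def permMean (g : Fin n → Fin n → ℝ) (a b : Fin n) : ℝ :=
  (1 / (n.factorial : ℝ)) * ∑ σ : Equiv.Perm (Fin n), g (σ a) (σ b)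

lemma abs_permMean_le {g : Fin n → Fin n → ℝ} {C : ℝ} (hg : ∀ a b, |g a b| ≤ C) (a b : Fin n) :
    |permMean g a b| ≤ C := by
  have h := abs_mean_le (f := fun σ : Equiv.Perm (Fin n) => g (σ a) (σ b)) fun σ => hg _ _
  rwa [Fintype.card_perm, Fintype.card_fin] at h

lemma permMean_apply_apply (g : Fin n → Fin n → ℝ) (τ : Equiv.Perm (Fin n)) (a b : Fin n) :
    permMean g (τ a) (τ b) = permMean g a b := by
  rw [permMean, permMean]
  congr 1
  exact Fintype.sum_equiv (Equiv.mulRight τ) _ _ fun σ => rfl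

lemma exists_perm_apply_apply {α : Type*} [DecidableEq α] {a b a' b' : α} (hab : a ≠ b)
    (hab' : a' ≠ b') : ∃ τ : Equiv.Perm α, τ a = a' ∧ τ b = b' := by
  refine ⟨Equiv.swap (Equiv.swap a a' b) b' * Equiv.swap a a', ?_, ?_⟩
  · rw [Equiv.Perm.mul_apply, Equiv.swap_apply_left]
    refine Equiv.swap_apply_of_ne_of_ne (fun h => hab ?_) hab'
    exact (Equiv.swap a a').injective (by rw [← h, Equiv.swap_apply_left])
  · rw [Equiv.Perm.mul_apply, Equiv.swap_apply_left]

lemma sum_permMean (g : Fin n → Fin n → ℝ) :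
    ∑ p : Fin n × Fin n, permMean g p.1 p.2 = ∑ p : Fin n × Fin n, g p.1 p.2 := by
  have hinv : ∀ σ : Equiv.Perm (Fin n),
      ∑ p : Fin n × Fin n, g (σ p.1) (σ p.2) = ∑ p : Fin n × Fin n, g p.1 p.2 := fun σ =>
    (σ.prodCongr σ).sum_comp (fun p : Fin n × Fin n => g p.1 p.2)
  have hfac : (n.factorial : ℝ) ≠ 0 := by positivity
  simp only [permMean]
  rw [← Finset.mul_sum, Finset.sum_comm, Finset.sum_congr rfl fun σ _ => hinv σ]
  simp only [Finset.sum_const, Finset.card_univ, Fintype.card_perm, Fintype.card_fin, nsmul_eq_mul]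
  field_simp

lemma sum_ite_diag (c : ℝ) :
    ∑ p : Fin n × Fin n, (if p.1 = p.2 then c else 0) = n * c := by
  rw [Fintype.sum_prod_type]
  simp

/-- The mean over permutations at two distinct indices is close to the overall mean. -/
lemma abs_permMean_sub_mean_le {g : Fin n → Fin n → ℝ} {C : ℝ} (hg : ∀ a b, |g a b| ≤ C)
    {a b : Fin n} (hab : a ≠ b) :
    |permMean g a b - (1 / (n : ℝ) ^ 2) * ∑ p : Fin n × Fin n, g p.1 p.2| ≤ 2 * C / n := by
  have hn : (0 : ℝ) < n := by exact_mod_cast a.pos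
  have hle : |∑ p : Fin n × Fin n, (permMean g a b - permMean g p.1 p.2)| ≤ n * (2 * C) := by
    rw [← sum_ite_diag]
    refine (Finset.abs_sum_le_sum_abs _ _).trans (Finset.sum_le_sum fun p _ => ?_)
    split_ifs with hp
    · have h1 := abs_permMean_le hg a b
      have h2 := abs_permMean_le hg p.1 p.2
      exact (abs_sub _ _).trans (by linarith)
    · obtain ⟨τ, h1, h2⟩ := exists_perm_apply_apply hab hp
      rw [← h1, ← h2, permMean_apply_apply, sub_self, abs_zero]
  rw [Finset.sum_sub_distrib, sum_permMean] at hle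
  simp only [Finset.sum_const, Finset.card_univ, Fintype.card_prod, Fintype.card_fin,
    nsmul_eq_mul, Nat.cast_mul] at hle
  rw [show permMean g a b - (1 / (n : ℝ) ^ 2) * ∑ p : Fin n × Fin n, g p.1 p.2
      = (1 / (n : ℝ) ^ 2) * (n * n * permMean g a b - ∑ p : Fin n × Fin n, g p.1 p.2) by
    field_simp, abs_mul, abs_of_pos (by positivity), show 2 * C / (n : ℝ)
      = (1 / (n : ℝ) ^ 2) * (n * (2 * C)) by field_simp]
  gcongr

lemma mean_perm_apply (f : Fin n → ℝ) (a : Fin n) :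
    (1 / (n.factorial : ℝ)) * ∑ σ : Equiv.Perm (Fin n), f (σ a) = (1 / (n : ℝ)) * ∑ b, f b := by
  have hn : (n : ℝ) ≠ 0 := by exact_mod_cast a.pos.ne'
  have hconst : ∀ b, ∑ σ : Equiv.Perm (Fin n), f (σ b) = ∑ σ : Equiv.Perm (Fin n), f (σ a) := by
    intro b
    refine Fintype.sum_equiv (Equiv.mulRight (Equiv.swap a b)) _ _ fun σ => ?_
    simp
  have hsum : ∑ b, ∑ σ : Equiv.Perm (Fin n), f (σ b) = n.factorial * ∑ b, f b := by
    rw [Finset.sum_comm, Finset.sum_congr rfl fun σ _ => Equiv.sum_comp σ f]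
    simp [Fintype.card_perm]
  rw [Finset.sum_congr rfl fun b _ => hconst b] at hsum
  simp only [Finset.sum_const, Finset.card_univ, Fintype.card_fin, nsmul_eq_mul] at hsum
  have hfac : (n.factorial : ℝ) ≠ 0 := by positivity
  field_simp
  linarith

/-- The mean over permutation vectors of a product over the components factorizes. -/
lemma mean_permVector_prod {e : ℕ} (F : Fin e → Equiv.Perm (Fin n) → ℝ) :
    (1 / (n.factorial : ℝ) ^ e) * ∑ ψ : Fin e → Equiv.Perm (Fin n), ∏ j, F j (ψ j)
      = ∏ j, ((1 / (n.factorial : ℝ)) * ∑ σ, F j σ) := by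
  rw [Finset.prod_mul_distrib, ← Fintype.prod_sum]
  simp

end PermutationMean

section PermutedDHSIC

lemma vStat_marginalKernel {d n : ℕ} {𝒳 : Fin d → Type*} (k : ∀ j, 𝒳 j → 𝒳 j → ℝ)
    (x : Fin n → ∀ j, 𝒳 j) :
    vStat (marginalKernel k) x
      = ∏ j, ((1 / (n : ℝ) ^ 2) * ∑ p : Fin n × Fin n, k j (x p.1 j) (x p.2 j)) := by
  let E : (Fin (2 * d) → Fin n) ≃ (Fin d → Fin n × Fin n) :=
    { toFun := fun i j => (i ⟨2 * j.val, by have := j.isLt; omega⟩,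
        i ⟨2 * j.val + 1, by have := j.isLt; omega⟩)
      invFun := fun v t => if t.val % 2 = 0 then (v ⟨t.val / 2, by have := t.isLt; omega⟩).1
        else (v ⟨t.val / 2, by have := t.isLt; omega⟩).2
      left_inv := by
        intro i
        ext1 t
        dsimp only
        split_ifs with ht
        · congr 1
          ext
          dsimp only
          omega
        · congr 1
          ext
          dsimp only
          omega
      right_inv := by
        intro v
        ext1 j
        have h1 : (2 * j.val + 1) / 2 = j.val := by omega
        have h2 : (2 * j.val + 1) % 2 = 1 := by omega
        simp [h1, h2] }
  rw [Finset.prod_mul_distrib, Fintype.prod_sum, ← E.sum_comp, vStat]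
  simp only [Finset.prod_const, Finset.card_univ, Fintype.card_fin]
  rw [div_pow, one_pow, ← pow_mul]
  rfl

lemma vStat_crossKernel {d n : ℕ} {𝒳 : Fin d → Type*} (k : ∀ j, 𝒳 j → 𝒳 j → ℝ)
    (x : Fin n → ∀ j, 𝒳 j) :
    vStat (crossKernel k) x
      = (1 / (n : ℝ)) * ∑ a, ∏ j, ((1 / (n : ℝ)) * ∑ b, k j (x a j) (x b j)) := by
  rw [vStat, ← (Fin.consEquiv fun _ : Fin (d + 1) => Fin n).sum_comp, Fintype.sum_prod_type]
  simp only [Finset.prod_mul_distrib, Fintype.prod_sum, ← Finset.mul_sum]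
  simp only [Finset.prod_const, Finset.card_univ, Fintype.card_fin, crossKernel,
    Fin.consEquiv, Equiv.coe_fn_mk, Fin.cons_zero, Fin.cons_succ]
  rw [← mul_assoc]
  congr 1
  rw [div_pow, one_pow, pow_succ]
  ring

variable {e n : ℕ} {𝒳 : Fin (e + 1) → Type*}

lemma vStat_marginalKernel_permAct (k : ∀ j, 𝒳 j → 𝒳 j → ℝ)
    (ψ : Fin e → Equiv.Perm (Fin n)) (D : Fin n → ∀ j, 𝒳 j) :
    vStat (marginalKernel k) (permAct (d := e + 1) ψ D) = vStat (marginalKernel k) D := by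
  rw [vStat_marginalKernel, vStat_marginalKernel, Fin.prod_univ_succ, Fin.prod_univ_succ]
  congr 1
  refine Finset.prod_congr rfl fun j _ => ?_
  congr 1
  exact ((ψ j).prodCongr (ψ j)).sum_comp
    (fun p : Fin n × Fin n => k j.succ (D p.1 j.succ) (D p.2 j.succ))

lemma mean_vStat_crossKernel_permAct (k : ∀ j, 𝒳 j → 𝒳 j → ℝ) (D : Fin n → ∀ j, 𝒳 j) :
    (1 / (n.factorial : ℝ) ^ e) * ∑ ψ : Fin e → Equiv.Perm (Fin n),
      vStat (crossKernel k) (permAct (d := e + 1) ψ D) = vStat (marginalKernel k) D := by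
  have hrow : ∀ ψ : Fin e → Equiv.Perm (Fin n),
      vStat (crossKernel k) (permAct (d := e + 1) ψ D)
        = (1 / (n : ℝ)) * ∑ a, ((1 / (n : ℝ)) * ∑ b, k 0 (D a 0) (D b 0))
          * ∏ j : Fin e, ((1 / (n : ℝ)) * ∑ b, k j.succ (D (ψ j a) j.succ) (D b j.succ)) := by
    intro ψ
    rw [vStat_crossKernel]
    congr 1
    refine Finset.sum_congr rfl fun a _ => ?_
    rw [Fin.prod_univ_succ]
    congr 1
    refine Finset.prod_congr rfl fun j _ => ?_
    congr 1
    exact Equiv.sum_comp (ψ j) (fun b => k j.succ (D (ψ j a) j.succ) (D b j.succ))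
  have hmean : ∀ j : Fin e, (1 / (n : ℝ)) * ∑ a, ((1 / (n : ℝ)) * ∑ b,
        k j.succ (D a j.succ) (D b j.succ))
      = (1 / (n : ℝ) ^ 2) * ∑ p : Fin n × Fin n, k j.succ (D p.1 j.succ) (D p.2 j.succ) := by
    intro j
    rw [← Finset.mul_sum, Fintype.sum_prod_type, ← mul_assoc]
    congr 1
    ring
  rw [Finset.sum_congr rfl fun ψ _ => hrow ψ, ← Finset.mul_sum, Finset.sum_comm, mul_left_comm,
    Finset.mul_sum]
  simp only [← Finset.mul_sum, mul_left_comm (1 / (n.factorial : ℝ) ^ e)]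
  have hfactor : ∀ a : Fin n, (1 / (n.factorial : ℝ) ^ e) * ∑ ψ : Fin e → Equiv.Perm (Fin n),
      ∏ j : Fin e, ((1 / (n : ℝ)) * ∑ b, k j.succ (D (ψ j a) j.succ) (D b j.succ))
      = ∏ j : Fin e, ((1 / (n : ℝ) ^ 2)
        * ∑ p : Fin n × Fin n, k j.succ (D p.1 j.succ) (D p.2 j.succ)) := by
    intro a
    rw [mean_permVector_prod
      (fun j σ => (1 / (n : ℝ)) * ∑ b, k j.succ (D (σ a) j.succ) (D b j.succ))]
    refine Finset.prod_congr rfl fun j _ => ?_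
    rw [mean_perm_apply (fun c => (1 / (n : ℝ)) * ∑ b, k j.succ (D c j.succ) (D b j.succ)),
      hmean j]
  rw [Finset.sum_congr rfl fun a _ => by rw [hfactor a], ← Finset.sum_mul,
    vStat_marginalKernel, Fin.prod_univ_succ, ← mul_assoc, ← Finset.mul_sum, ← mul_assoc,
    Fintype.sum_prod_type]
  congr 2
  ring

lemma mean_vStat_jointKernel_permAct (k : ∀ j, 𝒳 j → 𝒳 j → ℝ) (D : Fin n → ∀ j, 𝒳 j) :
    (1 / (n.factorial : ℝ) ^ e) * ∑ ψ : Fin e → Equiv.Perm (Fin n),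
      vStat (jointKernel k) (permAct (d := e + 1) ψ D)
    = (1 / (n : ℝ) ^ 2) * ∑ p : Fin n × Fin n, k 0 (D p.1 0) (D p.2 0)
      * ∏ j : Fin e, permMean (fun a b => k j.succ (D a j.succ) (D b j.succ)) p.1 p.2 := by
  have hrow : ∀ ψ : Fin e → Equiv.Perm (Fin n),
      vStat (jointKernel k) (permAct (d := e + 1) ψ D)
        = (1 / (n : ℝ) ^ 2) * ∑ p : Fin n × Fin n, k 0 (D p.1 0) (D p.2 0)
          * ∏ j : Fin e, k j.succ (D (ψ j p.1) j.succ) (D (ψ j p.2) j.succ) := by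
    intro ψ
    rw [vStat, Fintype.card_fin, ← (finTwoArrowEquiv (Fin n)).symm.sum_comp]
    congr 1
    refine Finset.sum_congr rfl fun p _ => ?_
    rw [jointKernel, Fin.prod_univ_succ]
    rfl
  rw [Finset.sum_congr rfl fun ψ _ => hrow ψ, ← Finset.mul_sum, Finset.sum_comm, mul_left_comm,
    Finset.mul_sum]
  simp only [← Finset.mul_sum, mul_left_comm (1 / (n.factorial : ℝ) ^ e)]
  congr 1
  refine Finset.sum_congr rfl fun p _ => ?_
  rw [mean_permVector_prod
    (fun j σ => k j.succ (D (σ p.1) j.succ) (D (σ p.2) j.succ))]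
  rfl

/-- The mean of dHSIC over all permutation vectors is of order `1 / n`, uniformly in the data. -/
lemma mean_dHSIC_permAct_le (hn : 0 < n) {k : ∀ j, 𝒳 j → 𝒳 j → ℝ} {C : ℝ} (hC1 : 1 ≤ C)
    (hC : ∀ j x y, |k j x y| ≤ C) (D : Fin n → ∀ j, 𝒳 j) :
    (1 / (n.factorial : ℝ) ^ e) * ∑ ψ : Fin e → Equiv.Perm (Fin n),
      dHSIC k (permAct (d := e + 1) ψ D)
    ≤ (2 * e * C ^ (e + 2) + 2 * C ^ (e + 1)) / n := by
  have hn' : (0 : ℝ) < n := by exact_mod_cast hn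
  have hfac : (n.factorial : ℝ) ≠ 0 := by positivity
  have hC0 : 0 ≤ C := by linarith
  simp only [dHSIC_eq_vStat, vStat_marginalKernel_permAct]
  rw [Finset.sum_sub_distrib, Finset.sum_add_distrib, ← Finset.mul_sum, mul_sub, mul_add,
    mul_left_comm _ (2 : ℝ), mean_vStat_crossKernel_permAct, mean_vStat_jointKernel_permAct]
  simp only [Finset.sum_const, Finset.card_univ, Fintype.card_fun, Fintype.card_perm,
    Fintype.card_fin, nsmul_eq_mul, Nat.cast_pow]
  rw [← mul_assoc (1 / (n.factorial : ℝ) ^ e), one_div_mul_cancel (pow_ne_zero _ hfac), one_mul]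
  set A : Fin e → ℝ := fun j =>
    (1 / (n : ℝ) ^ 2) * ∑ p : Fin n × Fin n, k j.succ (D p.1 j.succ) (D p.2 j.succ) with hA
  set R : Fin n × Fin n → Fin e → ℝ := fun p j =>
    permMean (fun a b => k j.succ (D a j.succ) (D b j.succ)) p.1 p.2 with hR
  have hmarg : vStat (marginalKernel k) D
      = (1 / (n : ℝ) ^ 2) * ∑ p : Fin n × Fin n, k 0 (D p.1 0) (D p.2 0) * ∏ j, A j := by
    rw [vStat_marginalKernel, Fin.prod_univ_succ, ← Finset.sum_mul, mul_assoc]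
  have hRC : ∀ p j, |R p j| ≤ C := fun p j => abs_permMean_le (fun a b => hC _ _ _) _ _
  have hAC : ∀ j, |A j| ≤ C := by
    intro j
    have : Nonempty (Fin n × Fin n) := ⟨(⟨0, hn⟩, ⟨0, hn⟩)⟩
    have h := abs_mean_le
      (f := fun p : Fin n × Fin n => k j.succ (D p.1 j.succ) (D p.2 j.succ)) fun p => hC _ _ _
    rwa [Fintype.card_prod, Fintype.card_fin, Nat.cast_mul, ← sq] at h
  have habs : ∀ a : Fin e → ℝ, (∀ j, |a j| ≤ C) → |∏ j, a j| ≤ C ^ e := by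
    intro a ha
    simpa using abs_prod_le_pow_card Finset.univ ha
  have hpoint : ∀ p : Fin n × Fin n,
      k 0 (D p.1 0) (D p.2 0) * ∏ j, R p j - k 0 (D p.1 0) (D p.2 0) * ∏ j, A j
        ≤ 2 * e * C ^ (e + 2) / n + if p.1 = p.2 then 2 * C ^ (e + 1) else 0 := by
    intro p
    rw [← mul_sub]
    refine (le_abs_self _).trans ?_
    rw [abs_mul]
    split_ifs with hp
    · have h1 : |∏ j, R p j - ∏ j, A j| ≤ 2 * C ^ e :=
        (abs_sub _ _).trans (by linarith [habs _ (hRC p), habs _ hAC])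
      calc _ ≤ C * (2 * C ^ e) := by
            gcongr
            exact hC _ _ _
        _ = 0 + 2 * C ^ (e + 1) := by ring
        _ ≤ _ := by gcongr; positivity
    · have h1 := abs_prod_sub_prod_le Finset.univ hC1 (hRC p) hAC
        (fun j => abs_permMean_sub_mean_le (g := fun a b => k j.succ (D a j.succ) (D b j.succ))
          (fun a b => hC _ _ _) hp)
      rw [Finset.card_univ, Fintype.card_fin] at h1
      calc _ ≤ C * (e * C ^ e * (2 * C / n)) := by
            gcongr
            exact hC _ _ _
        _ = _ := by ring
  have hsum := Finset.sum_le_sum fun p (_ : p ∈ Finset.univ) => hpoint p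
  rw [Finset.sum_sub_distrib, Finset.sum_add_distrib, sum_ite_diag] at hsum
  simp only [Finset.sum_const, Finset.card_univ, Fintype.card_prod, Fintype.card_fin,
    nsmul_eq_mul, Nat.cast_mul] at hsum
  rw [hmarg]
  set S := ∑ p : Fin n × Fin n, k 0 (D p.1 0) (D p.2 0) * ∏ j, R p j
  set T := ∑ p : Fin n × Fin n, k 0 (D p.1 0) (D p.2 0) * ∏ j, A j
  calc _ = (1 / (n : ℝ) ^ 2) * (S - T) := by ring
    _ ≤ (1 / (n : ℝ) ^ 2) * (n * n * (2 * e * C ^ (e + 2) / n) + n * (2 * C ^ (e + 1))) := by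
        gcongr
    _ = _ := by field_simp

end PermutedDHSIC

/-- The Markov inequality over the permutation vectors. -/
lemma permPValue_mul_dHSIC_le {e n : ℕ} {𝒳 : Fin (e + 1) → Type*} {k : ∀ j, 𝒳 j → 𝒳 j → ℝ}
    (D : Fin n → ∀ j, 𝒳 j)
    (hnonneg : ∀ ψ : Fin e → Equiv.Perm (Fin n), 0 ≤ dHSIC k (permAct (d := e + 1) ψ D)) :
    ((Finset.univ.filter (fun ψ : Fin e → Equiv.Perm (Fin n) =>
        dHSIC k (permAct (d := e + 1) ψ D) ≥ dHSIC k D)).card : ℝ)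
      / ((n.factorial : ℝ) ^ e) * dHSIC k D
    ≤ (1 / (n.factorial : ℝ) ^ e) * ∑ ψ : Fin e → Equiv.Perm (Fin n),
      dHSIC k (permAct (d := e + 1) ψ D) := by
  rw [div_mul_eq_mul_div, div_eq_inv_mul, ← one_div]
  gcongr
  rw [← nsmul_eq_mul]
  refine (Finset.card_nsmul_le_sum _ _ _ fun ψ hψ => (Finset.mem_filter.1 hψ).2).trans ?_
  exact Finset.sum_le_sum_of_subset_of_nonneg (Finset.filter_subset _ _) fun ψ _ _ => hnonneg ψ

/-- **Consistency of the dHSIC permutation test enumerating all permutations.**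
Assume each kernel `k^j` is measurable, bounded and positive semidefinite and the
product kernel is characteristic.  Let `μ` be a distribution that is not the product
of its `d` marginals (the alternative hypothesis) and let `D` be an i.i.d. sample of
size `n` from `μ`.  Then the all-permutations `p`-value
`p_D = (n!)^{-(d-1)} ⬝ #{ψ : dHSIĈ(ψ D) ≥ dHSIĈ(D)}` tends to `0` in probability;
in particular `P(p_D ≤ α) → 1` for every level `α ∈ (0,1)`, i.e. the test is
consistent. -/
theorem consistency_all_permutations
    {d : ℕ} (hd : 2 ≤ d)
    (𝒳 : Fin d → Type*) [∀ j, MeasurableSpace (𝒳 j)]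
    (k : ∀ j, 𝒳 j → 𝒳 j → ℝ)
    (hkmeas : ∀ j, Measurable (fun p : 𝒳 j × 𝒳 j => k j p.1 p.2))
    (hkbdd : ∃ C : ℝ, ∀ j x y, |k j x y| ≤ C)
    (hpsd : ∀ j, IsPSDKernel (k j))
    (hchar : IsCharacteristic (fun x y : ∀ j, 𝒳 j => ∏ j, k j (x j) (y j)))
    (μ : Measure (∀ j, 𝒳 j)) [IsProbabilityMeasure μ]
    (halt : μ ≠ Measure.pi (fun j => μ.map (fun x => x j))) :
    (∀ ε : ℝ, 0 < ε →
      Tendsto (fun n : ℕ =>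
          (Measure.pi fun _ : Fin n => μ)
            {D | ε ≤ (((Finset.univ.filter
                  (fun ψ : Fin (d-1) → Equiv.Perm (Fin n) =>
                    dHSIC k (permAct ψ D) ≥ dHSIC k D)).card : ℝ)
                / ((n.factorial : ℝ) ^ (d-1)))})
        atTop (nhds 0))
    ∧ ∀ α : ℝ, α ∈ Set.Ioo (0:ℝ) 1 →
      Tendsto (fun n : ℕ =>
          (Measure.pi fun _ : Fin n => μ)
            {D | (((Finset.univ.filter
                  (fun ψ : Fin (d-1) → Equiv.Perm (Fin n) =>
                    dHSIC k (permAct ψ D) ≥ dHSIC k D)).card : ℝ)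
                / ((n.factorial : ℝ) ^ (d-1))) ≤ α})
        atTop (nhds 1) := by
  obtain ⟨e, rfl⟩ : ∃ e, d = e + 1 := ⟨d - 1, by omega⟩
  obtain ⟨C₀, hC₀⟩ := hkbdd
  have hC : ∀ j x y, |k j x y| ≤ max C₀ 1 := fun j x y => (hC₀ j x y).trans (le_max_left _ _)
  have hsymm : ∀ j x y, k j x y = k j y x := fun j => (hpsd j).1
  have hpos := populationDHSIC_pos hkmeas hC hsymm hchar μ halt
  have hmain : ∀ ε : ℝ, 0 < ε →
      Tendsto (fun n : ℕ =>
          (Measure.pi fun _ : Fin n => μ)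
            {D | ε ≤ (((Finset.univ.filter
                  (fun ψ : Fin (e + 1 - 1) → Equiv.Perm (Fin n) =>
                    dHSIC k (permAct ψ D) ≥ dHSIC k D)).card : ℝ)
                / ((n.factorial : ℝ) ^ (e + 1 - 1)))})
        atTop (nhds 0) := by
    intro ε hε
    refine tendsto_of_tendsto_of_tendsto_of_le_of_le' tendsto_const_nhds
      (tendsto_measure_dHSIC_le hkmeas hC μ hpos) (Eventually.of_forall fun _ => zero_le) ?_
    have hsmall := (tendsto_const_div_atTop_nhds_zero_nat
      (2 * e * (max C₀ 1) ^ (e + 2) + 2 * (max C₀ 1) ^ (e + 1))).eventually_lt_const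
      (show 0 < ε * (populationDHSIC k μ / 2) by positivity)
    filter_upwards [hsmall, eventually_gt_atTop 0] with n hsmall hn
    have : NeZero n := ⟨hn.ne'⟩
    refine measure_mono fun D hD => ?_
    simp only [Set.mem_ofPred_eq] at hD ⊢
    by_contra! hlt
    have hbound := (permPValue_mul_dHSIC_le D
      fun ψ => dHSIC_nonneg hkmeas hC hsymm hchar _).trans
      (mean_dHSIC_permAct_le hn (le_max_right C₀ 1) hC D)
    have hprod : ε * (populationDHSIC k μ / 2) ≤ _ * dHSIC k D :=
      mul_le_mul hD hlt.le (by positivity) (hε.le.trans hD)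
    exact absurd (hprod.trans hbound) (not_le.2 hsmall)
  refine ⟨hmain, fun α hα => ?_⟩
  have hlim := ENNReal.Tendsto.sub (tendsto_const_nhds (x := (1 : ℝ≥0∞))) (hmain α hα.1)
    (Or.inl ENNReal.one_ne_top)
  rw [tsub_zero] at hlim
  refine tendsto_of_tendsto_of_tendsto_of_le_of_le hlim tendsto_const_nhds (fun n => ?_)
    fun n => prob_le_one
  rw [tsub_le_iff_right, ← measure_univ (μ := Measure.pi fun _ : Fin n => μ)]
  refine (measure_mono fun D _ => ?_).trans (measure_union_le _ _)
  exact le_total (α := ℝ) _ _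
end

section
/- Let 𝒳^1 and 𝒳^2 be measurable spaces, let k^1 and k^2 be measurable, bounded, positive semidefinite kernels on 𝒳^1 and 𝒳^2 respectively, and assume the product kernel k((x^1,x^2),(y^1,y^2)) = k^1(x^1,y^1)·k^2(x^2,y^2) on 𝒳^1 × 𝒳^2 is characteristic. Let μ be a probability measure on 𝒳^1 × 𝒳^2 that is not equal to the product of its two marginals, and let D = ((X_1^1, X_1^2), …, (X_n^1, X_n^2)) be an i.i.d. sample from μ. For a permutation σ of {1,…,n}, let σD denote the dataset with i-th element (X_i^1, X_{σ(i)}^2), and define the p-value p_D = (n!)^{−1} · #{σ ∈ S_n : HSIĈ(σD) ≥ HSIĈ(D)}. Then p_D → 0 in probability as n → ∞; in particular, the HSIC permutation test enumerating all n! permutations rejects with probability tending to 1 at every level α ∈ (0,1). -/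
open MeasureTheory ProbabilityTheory Filter
open scoped ENNReal Classical

/-- The empirical HSIC statistic of a paired dataset `((x_1^1,x_1^2), …, (x_n^1,x_n^2))`
(the `d = 2` case of the dHSIC statistic). -/
noncomputable def HSIC {𝒳₁ 𝒳₂ : Type*} (k₁ : 𝒳₁ → 𝒳₁ → ℝ) (k₂ : 𝒳₂ → 𝒳₂ → ℝ)
    {n : ℕ} (x : Fin n → 𝒳₁ × 𝒳₂) : ℝ :=
  (1/(n:ℝ)^2) * ∑ i : Fin n × Fin n,
      k₁ (x i.1).1 (x i.2).1 * k₂ (x i.1).2 (x i.2).2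
  + (1/(n:ℝ)^4) * ∑ i : Fin n × Fin n × Fin n × Fin n,
      k₁ (x i.1).1 (x i.2.1).1 * k₂ (x i.2.2.1).2 (x i.2.2.2).2
  - (2/(n:ℝ)^3) * ∑ i : Fin n × Fin n × Fin n,
      k₁ (x i.1).1 (x i.2.1).1 * k₂ (x i.1).2 (x i.2.2).2

/-- The action of a single permutation `σ` on a paired dataset: the `i`-th element of
`σ D` is `(x_i^1, x_{σ(i)}^2)`. -/
def permActPair {𝒳₁ 𝒳₂ : Type*} {n : ℕ} (σ : Equiv.Perm (Fin n))
    (x : Fin n → 𝒳₁ × 𝒳₂) : Fin n → 𝒳₁ × 𝒳₂ :=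
  fun i => ((x i).1, (x (σ i)).2)

/-- The doubly centred version of a square array. -/
noncomputable def doubleCenter {n : ℕ} (K : Fin n → Fin n → ℝ) (i j : Fin n) : ℝ :=
  K i j - (∑ b, K i b) / n - (∑ a, K a j) / n + (∑ a, ∑ b, K a b) / (n : ℝ) ^ 2

section DoubleCenter

variable {n : ℕ} (K : Fin n → Fin n → ℝ)

lemma sum_doubleCenter (hn : n ≠ 0) (i : Fin n) : ∑ j, doubleCenter K i j = 0 := by
  have hn' : (n : ℝ) ≠ 0 := by exact_mod_cast hn
  simp only [doubleCenter, Finset.sum_add_distrib, Finset.sum_sub_distrib, ← Finset.sum_div,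
    Finset.sum_const, Finset.card_univ, Fintype.card_fin, nsmul_eq_mul]
  rw [Finset.sum_comm]
  field_simp
  ring

lemma sum_mul_doubleCenter (L : Fin n → Fin n → ℝ) :
    ∑ i, ∑ j, doubleCenter K i j * L i j =
      ∑ i, ∑ j, K i j * L i j - (∑ i, (∑ b, K i b) * ∑ j, L i j) / n
        - (∑ j, (∑ a, K a j) * ∑ i, L i j) / n
        + (∑ a, ∑ b, K a b) * (∑ i, ∑ j, L i j) / (n : ℝ) ^ 2 := by
  simp only [doubleCenter, add_mul, sub_mul, Finset.sum_add_distrib, Finset.sum_sub_distrib,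
    div_mul_eq_mul_div, ← Finset.sum_div, ← Finset.mul_sum]
  congr 3
  rw [Finset.sum_comm]
  simp only [← Finset.mul_sum]

lemma sum_mul_mul_doubleCenter (c : Fin n → ℝ) :
    ∑ a, ∑ b, c a * c b * doubleCenter K a b =
      ∑ a, ∑ b, (c a - (∑ i, c i) / n) * (c b - (∑ i, c i) / n) * K a b := by
  have hleft := sum_mul_doubleCenter K (fun a b => c a * c b)
  simp only [mul_comm (c _ * c _)]
  rw [hleft]
  set m := ∑ i, c i with hm
  have hexp : ∀ a b, (c a - m / n) * (c b - m / n) * K a b =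
      K a b * (c a * c b) - (m / n) * (K a b * c a) - (m / n) * (K a b * c b)
        + (m / n) ^ 2 * K a b := fun a b => by ring
  simp only [hexp, Finset.sum_add_distrib, Finset.sum_sub_distrib, ← Finset.mul_sum,
    ← Finset.sum_mul, ← hm]
  rw [Finset.sum_comm (f := fun a b => K a b * c b)]
  have hrow : ∑ i, (∑ b, K i b) * (c i * m) = m * ∑ i, (∑ b, K i b) * c i := by
    rw [Finset.mul_sum]
    exact Finset.sum_congr rfl fun i _ => by ring
  have hcol : ∑ j, (∑ a, K a j) * (m * c j) = m * ∑ j, (∑ a, K a j) * c j := by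
    rw [Finset.mul_sum]
    exact Finset.sum_congr rfl fun j _ => by ring
  simp only [← Finset.sum_mul, hrow, hcol]
  ring

lemma doubleCenter_symm (hK : ∀ i j, K i j = K j i) (i j : Fin n) :
    doubleCenter K i j = doubleCenter K j i := by
  simp only [doubleCenter, hK i j, hK i, fun a => hK a j]
  ring

lemma abs_doubleCenter_le {C : ℝ} (hC : ∀ i j, |K i j| ≤ C) (i j : Fin n) :
    |doubleCenter K i j| ≤ 4 * C := by
  have hn : (0 : ℝ) < n := by exact_mod_cast i.pos
  have hsum : ∀ f : Fin n → ℝ, ∀ B : ℝ, (∀ i, |f i| ≤ B) → |∑ i, f i| ≤ n * B := by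
    intro f B hf
    refine (Finset.abs_sum_le_sum_abs _ _).trans ((Finset.sum_le_sum fun i _ => hf i).trans ?_)
    simp
  have hrow : |(∑ b, K i b) / n| ≤ C := by
    rw [abs_div, abs_of_pos hn, div_le_iff₀ hn, mul_comm]
    exact hsum _ _ fun b => hC i b
  have hcol : |(∑ a, K a j) / n| ≤ C := by
    rw [abs_div, abs_of_pos hn, div_le_iff₀ hn, mul_comm]
    exact hsum _ _ fun a => hC a j
  have hall : |(∑ a, ∑ b, K a b) / (n : ℝ) ^ 2| ≤ C := by
    rw [abs_div, abs_of_pos (by positivity : (0 : ℝ) < (n : ℝ) ^ 2), div_le_iff₀ (by positivity)]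
    refine (hsum _ _ fun a => hsum _ _ fun b => hC a b).trans (le_of_eq (by ring))
  have := hC i j
  rw [doubleCenter]
  rw [abs_le] at *
  constructor <;> linarith [this.1, this.2, hrow.1, hrow.2, hcol.1, hcol.2, hall.1, hall.2]

end DoubleCenter

/-- The Gram matrix of a positive semidefinite kernel is positive semidefinite. -/
lemma IsPSDKernel.posSemidef {α : Type*} {k : α → α → ℝ} (hk : IsPSDKernel k) {n : ℕ}
    (x : Fin n → α) : (Matrix.of fun i j => k (x i) (x j)).PosSemidef := by
  refine .of_dotProduct_mulVec_nonneg ?_ fun c => ?_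
  · ext i j
    simp [hk.1 (x i) (x j)]
  · refine (hk.2 n x c).trans (le_of_eq ?_)
    simp only [dotProduct, Matrix.mulVec, Matrix.of_apply, Finset.mul_sum, star_trivial]
    exact Finset.sum_congr rfl fun i _ => Finset.sum_congr rfl fun j _ => by ring

/-- The doubly centred Gram matrix of a positive semidefinite kernel is positive semidefinite. -/
lemma IsPSDKernel.posSemidef_doubleCenter {α : Type*} {k : α → α → ℝ} (hk : IsPSDKernel k)
    {n : ℕ} (x : Fin n → α) :
    (Matrix.of (doubleCenter fun i j => k (x i) (x j))).PosSemidef := by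
  refine .of_dotProduct_mulVec_nonneg ?_ fun c => ?_
  · ext i j
    simpa using doubleCenter_symm _ (fun i j => hk.1 (x i) (x j)) j i
  · refine (hk.2 n x fun a => c a - (∑ i, c i) / n).trans (le_of_eq ?_)
    rw [← sum_mul_mul_doubleCenter]
    simp only [dotProduct, Matrix.mulVec, Matrix.of_apply, Finset.mul_sum, star_trivial]
    exact Finset.sum_congr rfl fun i _ => Finset.sum_congr rfl fun j _ => by ring

section HSIC

variable {𝒳₁ 𝒳₂ : Type*} {k₁ : 𝒳₁ → 𝒳₁ → ℝ} {k₂ : 𝒳₂ → 𝒳₂ → ℝ} {n : ℕ}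

lemma HSIC_eq_sum_doubleCenter (h₁ : ∀ x y, k₁ x y = k₁ y x) (h₂ : ∀ x y, k₂ x y = k₂ y x)
    (x : Fin n → 𝒳₁ × 𝒳₂) :
    HSIC k₁ k₂ x = (1 / (n : ℝ) ^ 2) * ∑ i, ∑ j,
      doubleCenter (fun i j => k₁ (x i).1 (x j).1) i j * k₂ (x i).2 (x j).2 := by
  rw [sum_mul_doubleCenter (fun i j => k₁ (x i).1 (x j).1) (fun i j => k₂ (x i).2 (x j).2)]
  have hcol : ∑ j, (∑ a, k₁ (x a).1 (x j).1) * ∑ i, k₂ (x i).2 (x j).2 =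
      ∑ i, (∑ b, k₁ (x i).1 (x b).1) * ∑ j, k₂ (x i).2 (x j).2 := by
    refine Finset.sum_congr rfl fun j _ => ?_
    simp only [fun a => h₁ (x a).1 (x j).1, fun a => h₂ (x a).2 (x j).2]
  rw [hcol, HSIC]
  simp only [Fintype.sum_prod_type, ← Finset.mul_sum, ← Finset.sum_mul]
  ring

lemma HSIC_nonneg (hk₁ : IsPSDKernel k₁) (hk₂ : IsPSDKernel k₂) (x : Fin n → 𝒳₁ × 𝒳₂) :
    0 ≤ HSIC k₁ k₂ x := by
  rw [HSIC_eq_sum_doubleCenter hk₁.1 hk₂.1]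
  refine mul_nonneg (by positivity) ?_
  have h := ((hk₁.posSemidef_doubleCenter fun i => (x i).1).hadamard
    (hk₂.posSemidef fun i => (x i).2)).dotProduct_mulVec_nonneg (fun _ => 1)
  simpa [dotProduct, Matrix.mulVec] using h

/-- A centred row paired against the permutation average of an array only sees the diagonal. -/
lemma abs_sum_sum_perm_le {A L : Fin n → Fin n → ℝ} {C C' : ℝ} (i : Fin n)
    (hA : ∑ j, A i j = 0) (hAC : |A i i| ≤ C) (hL : ∀ i j, |L i j| ≤ C') :
    |∑ j, A i j * ∑ σ : Equiv.Perm (Fin n), L (σ i) (σ j)| ≤ C * (2 * (n.factorial * C')) := by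
  set g : Fin n → ℝ := fun j => ∑ σ : Equiv.Perm (Fin n), L (σ i) (σ j) with hg
  have hgC : ∀ j, |g j| ≤ n.factorial * C' := by
    intro j
    refine (Finset.abs_sum_le_sum_abs _ _).trans
      ((Finset.sum_le_sum fun σ _ => hL (σ i) (σ j)).trans ?_)
    simp [Fintype.card_perm]
  have hswap : ∀ j j', j ≠ i → j' ≠ i → g j = g j' := by
    intro j j' hj hj'
    refine Fintype.sum_equiv (Equiv.mulRight (Equiv.swap j j')) _ _ fun σ => ?_
    simp [Equiv.swap_apply_of_ne_of_ne hj.symm hj'.symm]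
  obtain ⟨v, hvC, hv⟩ : ∃ v, |v| ≤ n.factorial * C' ∧ ∀ j, j ≠ i → g j = v := by
    by_cases h : ∃ j, j ≠ i
    · obtain ⟨j, hj⟩ := h
      exact ⟨g j, hgC j, fun j' hj' => hswap j' j hj' hj⟩
    · push Not at h
      exact ⟨g i, hgC i, fun j hj => absurd (h j) hj⟩
  have hsum : ∑ j, A i j * g j = A i i * (g i - v) := by
    have hzero : ∑ j, A i j * v = 0 := by rw [← Finset.sum_mul, hA, zero_mul]
    rw [← sub_zero (∑ j, A i j * g j), ← hzero, ← Finset.sum_sub_distrib]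
    rw [Finset.sum_eq_single i]
    · ring
    · intro j _ hj
      rw [hv j hj, sub_self]
    · simp
  rw [hsum, abs_mul]
  refine mul_le_mul hAC ?_ (abs_nonneg _) ((abs_nonneg _).trans hAC)
  exact (abs_sub _ _).trans (by linarith [hgC i])

lemma sum_HSIC_permActPair_le (h₁ : ∀ x y, k₁ x y = k₁ y x) (h₂ : ∀ x y, k₂ x y = k₂ y x)
    {C₁ C₂ : ℝ} (hC₁ : ∀ x y, |k₁ x y| ≤ C₁) (hC₂ : ∀ x y, |k₂ x y| ≤ C₂) (hn : n ≠ 0)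
    (x : Fin n → 𝒳₁ × 𝒳₂) :
    ∑ σ : Equiv.Perm (Fin n), HSIC k₁ k₂ (permActPair σ x) ≤
      n.factorial * (8 * C₁ * C₂ / n) := by
  have hn' : (0 : ℝ) < n := by exact_mod_cast Nat.pos_of_ne_zero hn
  set A := doubleCenter (fun i j => k₁ (x i).1 (x j).1) with hA
  set L : Fin n → Fin n → ℝ := fun i j => k₂ (x i).2 (x j).2 with hL
  have heq : ∑ σ : Equiv.Perm (Fin n), HSIC k₁ k₂ (permActPair σ x) =
      (1 / (n : ℝ) ^ 2) * ∑ i, ∑ j, A i j * ∑ σ : Equiv.Perm (Fin n), L (σ i) (σ j) := by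
    simp only [HSIC_eq_sum_doubleCenter h₁ h₂, permActPair, ← Finset.mul_sum]
    rw [Finset.sum_comm]
    congr 1
    refine Finset.sum_congr rfl fun i _ => ?_
    rw [Finset.sum_comm]
    simp only [Finset.mul_sum, hA, hL]
  have hrow : ∀ i, ∑ j, A i j * ∑ σ : Equiv.Perm (Fin n), L (σ i) (σ j) ≤
      4 * C₁ * (2 * (n.factorial * C₂)) := fun i =>
    (le_abs_self _).trans (abs_sum_sum_perm_le i (sum_doubleCenter _ hn i)
      (abs_doubleCenter_le _ (fun _ _ => hC₁ _ _) i i) fun _ _ => hC₂ _ _)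
  rw [heq]
  calc _ ≤ (1 / (n : ℝ) ^ 2) * ∑ _i : Fin n, 4 * C₁ * (2 * (n.factorial * C₂)) := by
        gcongr with i
        exact hrow i
    _ = _ := by
        simp only [Finset.sum_const, Finset.card_univ, Fintype.card_fin, nsmul_eq_mul]
        field_simp
        ring

/-- Markov's inequality for the permutation distribution of the HSIC statistic. -/
lemma pvalue_mul_HSIC_le (hk₁ : IsPSDKernel k₁) (hk₂ : IsPSDKernel k₂)
    {C₁ C₂ : ℝ} (hC₁ : ∀ x y, |k₁ x y| ≤ C₁) (hC₂ : ∀ x y, |k₂ x y| ≤ C₂) (hn : n ≠ 0)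
    (x : Fin n → 𝒳₁ × 𝒳₂) :
    ((Finset.univ.filter (fun σ : Equiv.Perm (Fin n) =>
        HSIC k₁ k₂ (permActPair σ x) ≥ HSIC k₁ k₂ x)).card : ℝ) / (n.factorial : ℝ)
      * HSIC k₁ k₂ x ≤ 8 * C₁ * C₂ / n := by
  have hfac : (0 : ℝ) < n.factorial := by exact_mod_cast n.factorial_pos
  rw [div_mul_eq_mul_div, div_le_iff₀ hfac, mul_comm _ (n.factorial : ℝ)]
  refine le_trans ?_ (sum_HSIC_permActPair_le hk₁.1 hk₂.1 hC₁ hC₂ hn x)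
  rw [← nsmul_eq_mul]
  refine (Finset.card_nsmul_le_sum _ (fun σ => HSIC k₁ k₂ (permActPair σ x)) _
    fun σ hσ => (Finset.mem_filter.1 hσ).2).trans ?_
  exact Finset.sum_le_sum_of_subset_of_nonneg (Finset.filter_subset _ _)
    fun σ _ _ => HSIC_nonneg hk₁ hk₂ _

end HSIC

lemma card_filter_injective {ι : Type*} [Fintype ι] [DecidableEq ι] {n : ℕ} :
    ((Finset.univ.filter fun φ : ι → Fin n => Function.Injective φ).card) =
      n.descFactorial (Fintype.card ι) := by
  rw [← Fintype.card_subtype, Fintype.card_congr (Equiv.subtypeInjectiveEquivEmbedding ι (Fin n)),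
    Fintype.card_embedding_eq, Fintype.card_fin]

lemma measurePreserving_comp_injective {Ω ι : Type*} [Fintype ι] {n : ℕ}
    [MeasurableSpace Ω] (μ : Measure Ω) [IsProbabilityMeasure μ] {φ : ι → Fin n} (hφ : Function.Injective φ) :
    MeasurePreserving (fun D : Fin n → Ω => D ∘ φ) (Measure.pi fun _ => μ)
      (Measure.pi fun _ => μ) := by
  refine ⟨measurable_pi_lambda _ fun i => measurable_pi_apply (φ i), ?_⟩
  have h := (iIndepFun_pi (μ := fun _ : Fin n => μ) (X := fun _ => id)
    fun _ => aemeasurable_id).precomp hφ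
  refine (h.map_fun_eq_pi_map fun i => (measurable_pi_apply (φ i)).aemeasurable).trans ?_
  congr with i : 1
  exact (measurePreserving_eval (fun _ : Fin n => μ) (φ i)).map_eq

section VStatistic

variable {Ω ι : Type*} [Fintype ι] [DecidableEq ι] {n : ℕ}

/-- The V-statistic with kernel `h` of the sample `D`. -/
noncomputable def vStatistic (h : (ι → Ω) → ℝ) (D : Fin n → Ω) : ℝ :=
  (1 / (n : ℝ) ^ Fintype.card ι) * ∑ φ : ι → Fin n, h (D ∘ φ)

lemma abs_vStatistic_le {h : (ι → Ω) → ℝ} {C : ℝ} (hC : ∀ x, |h x| ≤ C) (hn : n ≠ 0)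
    (D : Fin n → Ω) : |vStatistic h D| ≤ C := by
  have hn' : (0 : ℝ) < n := by exact_mod_cast Nat.pos_of_ne_zero hn
  rw [vStatistic, abs_mul, abs_of_pos (by positivity), one_div, inv_mul_le_iff₀ (by positivity)]
  refine (Finset.abs_sum_le_sum_abs _ _).trans ((Finset.sum_le_sum fun φ _ => hC (D ∘ φ)).trans ?_)
  simp

lemma vStatistic_mul_vStatistic {κ : Type*} [Fintype κ] [DecidableEq κ] (h : (ι → Ω) → ℝ) (g : (κ → Ω) → ℝ)
    (D : Fin n → Ω) : vStatistic h D * vStatistic g D =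
      vStatistic (fun x : ι ⊕ κ → Ω => h (x ∘ Sum.inl) * g (x ∘ Sum.inr)) D := by
  simp only [vStatistic, Fintype.card_sum, pow_add]
  have hsum : ∑ φ : ι ⊕ κ → Fin n, h ((D ∘ φ) ∘ Sum.inl) * g ((D ∘ φ) ∘ Sum.inr) =
      ∑ p : (ι → Fin n) × (κ → Fin n), h (D ∘ p.1) * g (D ∘ p.2) :=
    Fintype.sum_equiv (Equiv.sumArrowEquivProdArrow ι κ (Fin n)) _ _ fun φ => rfl
  rw [hsum, Fintype.sum_prod_type]
  simp only [← Finset.sum_mul_sum]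
  ring

lemma measurable_vStatistic [MeasurableSpace Ω] {h : (ι → Ω) → ℝ} (hh : Measurable h) :
    Measurable (vStatistic h : (Fin n → Ω) → ℝ) := by
  unfold vStatistic
  refine Measurable.const_mul (Finset.measurable_sum _ fun φ _ => hh.comp ?_) _
  exact measurable_pi_lambda _ fun i => measurable_pi_apply (φ i)

variable [MeasurableSpace Ω] (μ : Measure Ω) [IsProbabilityMeasure μ]

lemma tendsto_integral_vStatistic {h : (ι → Ω) → ℝ} (hh : Measurable h) {C : ℝ}
    (hC : ∀ x, |h x| ≤ C) :
    Tendsto (fun n : ℕ => ∫ D, vStatistic h D ∂(Measure.pi fun _ : Fin n => μ)) atTop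
      (nhds (∫ x, h x ∂(Measure.pi fun _ : ι => μ))) := by
  set θ := ∫ x, h x ∂(Measure.pi fun _ : ι => μ) with hθ
  have hcomp : ∀ n : ℕ, ∀ φ : ι → Fin n, Measurable fun D : Fin n → Ω => h (D ∘ φ) :=
    fun n φ => hh.comp (measurable_pi_lambda _ fun i => measurable_pi_apply (φ i))
  have hint : ∀ n : ℕ, ∀ φ : ι → Fin n,
      Integrable (fun D : Fin n → Ω => h (D ∘ φ)) (Measure.pi fun _ => μ) := fun n φ =>
    .of_bound (hcomp n φ).aestronglyMeasurable C (ae_of_all _ fun D => hC _)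
  have hinj : ∀ n : ℕ, ∀ φ : ι → Fin n, Function.Injective φ →
      ∫ D, h (D ∘ φ) ∂(Measure.pi fun _ : Fin n => μ) = θ := by
    intro n φ hφ
    have hp := measurePreserving_comp_injective μ hφ
    rw [hθ, ← hp.map_eq, integral_map hp.measurable.aemeasurable hh.aestronglyMeasurable]
  have hθC : |θ| ≤ C := by
    simpa using norm_integral_le_of_norm_le_const (μ := Measure.pi fun _ : ι => μ)
      (ae_of_all _ fun x => (Real.norm_eq_abs (h x)).trans_le (hC x))
  have hratio : Tendsto (fun n : ℕ =>
      (n.descFactorial (Fintype.card ι) : ℝ) / (n : ℝ) ^ Fintype.card ι) atTop (nhds 1) := by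
    refine (Asymptotics.isEquivalent_iff_tendsto_one ?_).1
      (isEquivalent_descFactorial (Fintype.card ι))
    filter_upwards [eventually_ne_atTop 0] with n hn
    positivity
  have hbound : ∀ᶠ n : ℕ in atTop,
      |∫ D, vStatistic h D ∂(Measure.pi fun _ : Fin n => μ) - θ| ≤
        2 * C * (1 - (n.descFactorial (Fintype.card ι) : ℝ) / (n : ℝ) ^ Fintype.card ι) := by
    filter_upwards [eventually_ne_atTop 0] with n hn
    have hn' : (0 : ℝ) < (n : ℝ) ^ Fintype.card ι := by positivity
    have heq : ∫ D, vStatistic h D ∂(Measure.pi fun _ : Fin n => μ) - θ =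
        (1 / (n : ℝ) ^ Fintype.card ι) * ∑ φ : ι → Fin n,
          (∫ D, h (D ∘ φ) ∂(Measure.pi fun _ : Fin n => μ) - θ) := by
      simp only [vStatistic]
      rw [integral_const_mul, integral_finsetSum _ fun φ _ => hint n φ, Finset.sum_sub_distrib]
      simp
      field_simp
    have hsum : |∑ φ : ι → Fin n, (∫ D, h (D ∘ φ) ∂(Measure.pi fun _ : Fin n => μ) - θ)| ≤
        2 * C * ((n : ℝ) ^ Fintype.card ι - n.descFactorial (Fintype.card ι)) := by
      refine (Finset.abs_sum_le_sum_abs _ _).trans ?_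
      calc _ ≤ ∑ φ : ι → Fin n, (2 * C - if Function.Injective φ then 2 * C else 0) := by
            refine Finset.sum_le_sum fun φ _ => ?_
            split_ifs with hφ
            · simp [hinj n φ hφ]
            · have : |∫ D, h (D ∘ φ) ∂(Measure.pi fun _ : Fin n => μ)| ≤ C := by
                simpa using norm_integral_le_of_norm_le_const
                  (μ := Measure.pi fun _ : Fin n => μ)
                  (ae_of_all _ fun D => (Real.norm_eq_abs (h (D ∘ φ))).trans_le (hC _))
              exact (abs_sub _ _).trans (by linarith)
        _ = _ := by
            rw [Finset.sum_sub_distrib, ← Finset.sum_filter, Finset.sum_const, Finset.sum_const,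
              card_filter_injective]
            simp
            ring
    rw [heq, abs_mul, abs_of_pos (by positivity), one_div, inv_mul_le_iff₀ hn']
    refine hsum.trans (le_of_eq ?_)
    field_simp
  rw [tendsto_iff_dist_tendsto_zero]
  refine squeeze_zero' (Eventually.of_forall fun _ => dist_nonneg) hbound ?_
  simpa using (hratio.const_sub 1).const_mul (2 * C)

/-- Bounded V-statistics are consistent: they fall below any level under the mean of their kernel
with probability tending to zero. -/
lemma tendsto_measure_vStatistic_le {h : (ι → Ω) → ℝ} (hh : Measurable h) {C : ℝ}
    (hC : ∀ x, |h x| ≤ C) {t : ℝ} (ht : t < ∫ x, h x ∂(Measure.pi fun _ : ι => μ)) :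
    Tendsto (fun n : ℕ => (Measure.pi fun _ : Fin n => μ) {D | vStatistic h D ≤ t}) atTop
      (nhds 0) := by
  set θ := ∫ x, h x ∂(Measure.pi fun _ : ι => μ) with hθ
  set g : (ι ⊕ ι → Ω) → ℝ := fun x => h (x ∘ Sum.inl) * h (x ∘ Sum.inr) with hg
  have hl : Measurable fun x : ι ⊕ ι → Ω => x ∘ Sum.inl :=
    measurable_pi_lambda _ fun i => measurable_pi_apply (Sum.inl i)
  have hr : Measurable fun x : ι ⊕ ι → Ω => x ∘ Sum.inr :=
    measurable_pi_lambda _ fun i => measurable_pi_apply (Sum.inr i)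
  have hgm : Measurable g := (hh.comp hl).mul (hh.comp hr)
  have hgC : ∀ x, |g x| ≤ C * C := fun x => by
    rw [hg, abs_mul]
    exact mul_le_mul (hC _) (hC _) (abs_nonneg _) ((abs_nonneg _).trans (hC (x ∘ Sum.inl)))
  have hgθ : ∫ x, g x ∂(Measure.pi fun _ : ι ⊕ ι => μ) = θ ^ 2 := by
    have hp := measurePreserving_sumPiEquivProdPi (fun _ : ι ⊕ ι => μ)
    have := hp.integral_comp' (g := fun p => h p.1 * h p.2)
    rw [integral_prod_mul] at this
    rw [sq]
    exact this
  have hvar : Tendsto (fun n : ℕ => ∫ D, (vStatistic h D - θ) ^ 2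
      ∂(Measure.pi fun _ : Fin n => μ)) atTop (nhds 0) := by
    have hlim := ((tendsto_integral_vStatistic μ hgm hgC).sub
      ((tendsto_integral_vStatistic μ hh hC).const_mul (2 * θ))).add_const (θ ^ 2)
    rw [hgθ, ← hθ, show θ ^ 2 - 2 * θ * θ + θ ^ 2 = 0 by ring] at hlim
    refine hlim.congr' ?_
    filter_upwards [eventually_ne_atTop 0] with n hn
    have hint : Integrable (vStatistic h) (Measure.pi fun _ : Fin n => μ) :=
      .of_bound (measurable_vStatistic hh).aestronglyMeasurable C
        (ae_of_all _ fun D => abs_vStatistic_le hC hn D)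
    have hint' : Integrable (vStatistic g) (Measure.pi fun _ : Fin n => μ) :=
      .of_bound (measurable_vStatistic hgm).aestronglyMeasurable (C * C)
        (ae_of_all _ fun D => abs_vStatistic_le hgC hn D)
    have hexp : ∀ D : Fin n → Ω, (vStatistic h D - θ) ^ 2 =
        vStatistic g D - 2 * θ * vStatistic h D + θ ^ 2 := fun D => by
      rw [hg, ← vStatistic_mul_vStatistic]
      ring
    simp only [hexp]
    rw [integral_add (f := fun D => vStatistic g D - 2 * θ * vStatistic h D)
      (hint'.sub (hint.const_mul _)) (integrable_const _), integral_sub hint' (hint.const_mul _), integral_const_mul]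
    simp
  have hpos : 0 < (θ - t) ^ 2 := by
    have := sub_pos.2 ht
    positivity
  have hreal : Tendsto (fun n : ℕ => (Measure.pi fun _ : Fin n => μ).real
      {D | vStatistic h D ≤ t}) atTop (nhds 0) := by
    have hlim := hvar.div_const ((θ - t) ^ 2)
    rw [zero_div] at hlim
    refine squeeze_zero' (Eventually.of_forall fun _ => measureReal_nonneg) ?_ hlim
    filter_upwards [eventually_ne_atTop 0] with n hn
    rw [le_div_iff₀ hpos, mul_comm]
    have hm : Measurable fun D : Fin n → Ω => (vStatistic h D - θ) ^ 2 :=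
      ((measurable_vStatistic hh).sub_const θ).pow_const 2
    have hint : Integrable (fun D => (vStatistic h D - θ) ^ 2)
        (Measure.pi fun _ : Fin n => μ) := by
      refine .of_bound hm.aestronglyMeasurable ((C + |θ|) ^ 2) (ae_of_all _ fun D => ?_)
      rw [norm_pow]
      gcongr
      exact (abs_sub _ _).trans (by linarith [abs_vStatistic_le hC hn D])
    refine le_trans ?_ (mul_meas_ge_le_integral_of_nonneg
      (ae_of_all _ fun D => sq_nonneg (vStatistic h D - θ)) hint ((θ - t) ^ 2))
    refine mul_le_mul_of_nonneg_left (measureReal_mono fun D hD => ?_) hpos.le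
    simp only [Set.mem_ofPred_eq] at hD ⊢
    nlinarith
  rw [← ENNReal.tendsto_toReal_iff (fun _ => measure_ne_top _ _) ENNReal.zero_ne_top]
  simpa [Measure.real] using hreal

end VStatistic

section Consistency

variable {𝒳₁ 𝒳₂ : Type*} {k₁ : 𝒳₁ → 𝒳₁ → ℝ} {k₂ : 𝒳₂ → 𝒳₂ → ℝ}

/-- The kernel of order four whose V-statistic is the empirical HSIC. -/
def hsicKernel (k₁ : 𝒳₁ → 𝒳₁ → ℝ) (k₂ : 𝒳₂ → 𝒳₂ → ℝ) (z : Fin 4 → 𝒳₁ × 𝒳₂) : ℝ :=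
  k₁ (z 0).1 (z 1).1 * k₂ (z 0).2 (z 1).2 + k₁ (z 0).1 (z 1).1 * k₂ (z 2).2 (z 3).2
    - 2 * (k₁ (z 0).1 (z 1).1 * k₂ (z 0).2 (z 2).2)

lemma sum_fin_four_arrow {α : Type*} [Fintype α] (f : α → α → α → α → ℝ) :
    ∑ φ : Fin 4 → α, f (φ 0) (φ 1) (φ 2) (φ 3) = ∑ a, ∑ b, ∑ c, ∑ d, f a b c d := by
  simp only [← Fintype.sum_prod_type']
  exact Fintype.sum_equiv
    { toFun := fun φ => (φ 0, φ 1, φ 2, φ 3)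
      invFun := fun p => ![p.1, p.2.1, p.2.2.1, p.2.2.2]
      left_inv := fun φ => by ext i; fin_cases i <;> rfl
      right_inv := fun p => rfl } _ _ fun φ => rfl

lemma HSIC_eq_vStatistic {n : ℕ} (hn : n ≠ 0) (x : Fin n → 𝒳₁ × 𝒳₂) :
    HSIC k₁ k₂ x = vStatistic (hsicKernel k₁ k₂) x := by
  have hn' : (n : ℝ) ≠ 0 := by exact_mod_cast hn
  simp only [vStatistic, hsicKernel, Function.comp_apply]
  rw [sum_fin_four_arrow (fun a b c d => k₁ (x a).1 (x b).1 * k₂ (x a).2 (x b).2 +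
    k₁ (x a).1 (x b).1 * k₂ (x c).2 (x d).2 - 2 * (k₁ (x a).1 (x b).1 * k₂ (x a).2 (x c).2))]
  simp only [HSIC, Fintype.sum_prod_type, Finset.sum_add_distrib, Finset.sum_sub_distrib,
    Finset.sum_const, Finset.card_univ, Fintype.card_fin, nsmul_eq_mul, ← Finset.mul_sum]
  field_simp
  simp only [← Finset.sum_mul, ← Finset.mul_sum]
  ring

lemma abs_hsicKernel_le {C₁ C₂ : ℝ} (hC₁ : ∀ x y, |k₁ x y| ≤ C₁) (hC₂ : ∀ x y, |k₂ x y| ≤ C₂)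
    (z : Fin 4 → 𝒳₁ × 𝒳₂) : |hsicKernel k₁ k₂ z| ≤ 4 * (C₁ * C₂) := by
  have h : ∀ x y u v, |k₁ x y * k₂ u v| ≤ C₁ * C₂ := fun x y u v => by
    rw [abs_mul]
    exact mul_le_mul (hC₁ _ _) (hC₂ _ _) (abs_nonneg _) ((abs_nonneg _).trans (hC₁ x y))
  have ha := abs_le.1 (h (z 0).1 (z 1).1 (z 0).2 (z 1).2)
  have hb := abs_le.1 (h (z 0).1 (z 1).1 (z 2).2 (z 3).2)
  have hc := abs_le.1 (h (z 0).1 (z 1).1 (z 0).2 (z 2).2)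
  rw [hsicKernel, abs_le]
  constructor <;> linarith [ha.1, ha.2, hb.1, hb.2, hc.1, hc.2]

variable [MeasurableSpace 𝒳₁] [MeasurableSpace 𝒳₂]

lemma measurable_hsicKernel (h₁ : Measurable (fun p : 𝒳₁ × 𝒳₁ => k₁ p.1 p.2))
    (h₂ : Measurable (fun p : 𝒳₂ × 𝒳₂ => k₂ p.1 p.2)) : Measurable (hsicKernel k₁ k₂) := by
  have hm₁ : ∀ i j : Fin 4, Measurable fun z : Fin 4 → 𝒳₁ × 𝒳₂ => k₁ (z i).1 (z j).1 :=
    fun i j => h₁.comp (by fun_prop : Measurable fun z : Fin 4 → 𝒳₁ × 𝒳₂ => ((z i).1, (z j).1))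
  have hm₂ : ∀ i j : Fin 4, Measurable fun z : Fin 4 → 𝒳₁ × 𝒳₂ => k₂ (z i).2 (z j).2 :=
    fun i j => h₂.comp (by fun_prop : Measurable fun z : Fin 4 → 𝒳₁ × 𝒳₂ => ((z i).2, (z j).2))
  exact (((hm₁ 0 1).mul (hm₂ 0 1)).add ((hm₁ 0 1).mul (hm₂ 2 3))).sub
    (((hm₁ 0 1).mul (hm₂ 0 2)).const_mul 2)

/-- The mean of the HSIC kernel is the squared MMD between the joint law and the product of
its marginals. -/
lemma integral_hsicKernel (h₁ : Measurable (fun p : 𝒳₁ × 𝒳₁ => k₁ p.1 p.2))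
    (h₂ : Measurable (fun p : 𝒳₂ × 𝒳₂ => k₂ p.1 p.2))
    {C₁ C₂ : ℝ} (hC₁ : ∀ x y, |k₁ x y| ≤ C₁) (hC₂ : ∀ x y, |k₂ x y| ≤ C₂)
    (μ ν : Measure (𝒳₁ × 𝒳₂)) [IsProbabilityMeasure μ]
    (hν : ν = (μ.map Prod.fst).prod (μ.map Prod.snd)) :
    ∫ z, hsicKernel k₁ k₂ z ∂(Measure.pi fun _ => μ) =
      (∫ x, ∫ y, k₁ x.1 y.1 * k₂ x.2 y.2 ∂μ ∂μ) + (∫ x, ∫ y, k₁ x.1 y.1 * k₂ x.2 y.2 ∂ν ∂ν)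
        - 2 * ∫ x, ∫ y, k₁ x.1 y.1 * k₂ x.2 y.2 ∂ν ∂μ := by
  have := Measure.isProbabilityMeasure_map (μ := μ) measurable_fst.aemeasurable
  have := Measure.isProbabilityMeasure_map (μ := μ) measurable_snd.aemeasurable
  have : IsProbabilityMeasure ν := hν ▸ inferInstance
  set P : Measure (Fin 4 → 𝒳₁ × 𝒳₂) := Measure.pi fun _ => μ
  set K : (𝒳₁ × 𝒳₂) × (𝒳₁ × 𝒳₂) → ℝ := fun p => k₁ p.1.1 p.2.1 * k₂ p.1.2 p.2.2 with hK
  have hKm : Measurable K := by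
    have hm₁ : Measurable fun p : (𝒳₁ × 𝒳₂) × (𝒳₁ × 𝒳₂) => (p.1.1, p.2.1) := by fun_prop
    have hm₂ : Measurable fun p : (𝒳₁ × 𝒳₂) × (𝒳₁ × 𝒳₂) => (p.1.2, p.2.2) := by fun_prop
    exact (h₁.comp hm₁).mul (h₂.comp hm₂)
  have hKC : ∀ p, ‖K p‖ ≤ C₁ * C₂ := fun p => by
    rw [hK, norm_mul]
    exact mul_le_mul (hC₁ _ _) (hC₂ _ _) (norm_nonneg _)
      ((abs_nonneg _).trans (hC₁ p.1.1 p.2.1))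
  have hindep : iIndepFun (fun i (z : Fin 4 → 𝒳₁ × 𝒳₂) => z i) P :=
    iIndepFun_pi (μ := fun _ : Fin 4 => μ) (X := fun _ => id) fun _ => aemeasurable_id
  have heval : ∀ i : Fin 4, P.map (fun z => z i) = μ := fun i =>
    (measurePreserving_eval (fun _ : Fin 4 => μ) i).map_eq
  have hpair : ∀ i j : Fin 4, i ≠ j → P.map (fun z => ((z i).1, (z j).2)) = ν := by
    intro i j hij
    have h := ((hindep.indepFun hij).comp measurable_fst measurable_snd).map_prod_eq_prod_map_map
      (measurable_fst.comp (measurable_pi_apply i)).aemeasurable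
      (measurable_snd.comp (measurable_pi_apply j)).aemeasurable
    rw [← Measure.map_map measurable_fst (by fun_prop),
      ← Measure.map_map measurable_snd (by fun_prop), heval, heval, ← hν] at h
    exact h
  have hint : ∀ (ρ₁ ρ₂ : Measure (𝒳₁ × 𝒳₂)) [IsProbabilityMeasure ρ₁] [IsProbabilityMeasure ρ₂]
      (X Y : (Fin 4 → 𝒳₁ × 𝒳₂) → 𝒳₁ × 𝒳₂), Measurable X → Measurable Y → IndepFun X Y P →
      P.map X = ρ₁ → P.map Y = ρ₂ →
      ∫ z, K (X z, Y z) ∂P = ∫ x, ∫ y, k₁ x.1 y.1 * k₂ x.2 y.2 ∂ρ₂ ∂ρ₁ := by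
    intro ρ₁ ρ₂ _ _ X Y hX hY hXY hX' hY'
    have h := hXY.map_prod_eq_prod_map_map hX.aemeasurable hY.aemeasurable
    rw [hX', hY'] at h
    rw [← integral_map (φ := fun z => (X z, Y z)) (hX.prodMk hY).aemeasurable
      hKm.aestronglyMeasurable, h]
    exact integral_prod _ (.of_bound hKm.aestronglyMeasurable _ (ae_of_all _ hKC))
  have hintegrable : ∀ f : (Fin 4 → 𝒳₁ × 𝒳₂) → (𝒳₁ × 𝒳₂) × (𝒳₁ × 𝒳₂), Measurable f →
      Integrable (fun z => K (f z)) P := fun f hf =>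
    .of_bound (hKm.comp hf).aestronglyMeasurable _ (ae_of_all _ fun z => hKC _)
  have hmeas : ∀ i : Fin 4, Measurable fun z : Fin 4 → 𝒳₁ × 𝒳₂ => z i := measurable_pi_apply
  have hswap : Measurable fun p : (𝒳₁ × 𝒳₂) × (𝒳₁ × 𝒳₂) => (p.1.1, p.2.2) := by fun_prop
  have hjoint := hint μ μ (fun z => z 0) (fun z => z 1) (hmeas 0) (hmeas 1)
    (hindep.indepFun (by decide)) (heval 0) (heval 1)
  have hprod := hint ν ν (fun z => ((z 0).1, (z 2).2)) (fun z => ((z 1).1, (z 3).2))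
    (by fun_prop) (by fun_prop)
    ((hindep.indepFun_prodMk_prodMk hmeas 0 2 1 3 (by decide) (by decide) (by decide)
      (by decide)).comp hswap hswap)
    (hpair 0 2 (by decide)) (hpair 1 3 (by decide))
  have hcross := hint μ ν (fun z => z 0) (fun z => ((z 1).1, (z 2).2))
    (by fun_prop) (by fun_prop)
    ((hindep.indepFun_prodMk hmeas 1 2 0 (by decide) (by decide)).symm.comp measurable_id hswap)
    (heval 0) (hpair 1 2 (by decide))
  rw [← hjoint, ← hprod, ← hcross, ← integral_const_mul,
    ← integral_add (hintegrable _ (by fun_prop)) (hintegrable _ (by fun_prop)),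
    ← integral_sub (f := fun z => K (z 0, z 1) + K (((z 0).1, (z 2).2), ((z 1).1, (z 3).2)))
      ((hintegrable _ (by fun_prop)).add (hintegrable _ (by fun_prop)))
      ((hintegrable _ (by fun_prop)).const_mul 2)]
  rfl

end Consistency

/-- **Consistency of the HSIC permutation test enumerating all `n!` permutations.**
Let `k^1, k^2` be measurable, bounded, positive semidefinite kernels whose product
kernel on `𝒳^1 × 𝒳^2` is characteristic, and let `μ` be a distribution on
`𝒳^1 × 𝒳^2` that is not the product of its two marginals.  For an i.i.d. sample `D`
of size `n` from `μ`, the `p`-value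
`p_D = (n!)^{-1} ⬝ #{σ ∈ S_n : HSIĈ(σ D) ≥ HSIĈ(D)}` tends to `0` in probability;
in particular, the test rejects with probability tending to `1` at every level
`α ∈ (0,1)`. -/
theorem consistency_HSIC_all_permutations
    {𝒳₁ 𝒳₂ : Type*} [MeasurableSpace 𝒳₁] [MeasurableSpace 𝒳₂]
    (k₁ : 𝒳₁ → 𝒳₁ → ℝ) (k₂ : 𝒳₂ → 𝒳₂ → ℝ)
    (hk₁meas : Measurable (fun p : 𝒳₁ × 𝒳₁ => k₁ p.1 p.2))
    (hk₂meas : Measurable (fun p : 𝒳₂ × 𝒳₂ => k₂ p.1 p.2))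
    (hk₁bdd : ∃ C : ℝ, ∀ x y, |k₁ x y| ≤ C)
    (hk₂bdd : ∃ C : ℝ, ∀ x y, |k₂ x y| ≤ C)
    (hpsd₁ : IsPSDKernel k₁) (hpsd₂ : IsPSDKernel k₂)
    (hchar : IsCharacteristic
      (fun x y : 𝒳₁ × 𝒳₂ => k₁ x.1 y.1 * k₂ x.2 y.2))
    (μ : Measure (𝒳₁ × 𝒳₂)) [IsProbabilityMeasure μ]
    (halt : μ ≠ (μ.map Prod.fst).prod (μ.map Prod.snd)) :
    (∀ ε : ℝ, 0 < ε →
      Tendsto (fun n : ℕ =>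
          (Measure.pi fun _ : Fin n => μ)
            {D | ε ≤ (((Finset.univ.filter
                  (fun σ : Equiv.Perm (Fin n) =>
                    HSIC k₁ k₂ (permActPair σ D) ≥ HSIC k₁ k₂ D)).card : ℝ)
                / (n.factorial : ℝ))})
        atTop (nhds 0))
    ∧ ∀ α : ℝ, α ∈ Set.Ioo (0:ℝ) 1 →
      Tendsto (fun n : ℕ =>
          (Measure.pi fun _ : Fin n => μ)
            {D | (((Finset.univ.filter
                  (fun σ : Equiv.Perm (Fin n) =>
                    HSIC k₁ k₂ (permActPair σ D) ≥ HSIC k₁ k₂ D)).card : ℝ)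
                / (n.factorial : ℝ)) ≤ α})
        atTop (nhds 1) := by
  obtain ⟨C₁, hC₁⟩ := hk₁bdd
  obtain ⟨C₂, hC₂⟩ := hk₂bdd
  set ν := (μ.map Prod.fst).prod (μ.map Prod.snd) with hν
  have := Measure.isProbabilityMeasure_map (μ := μ) measurable_fst.aemeasurable
  have := Measure.isProbabilityMeasure_map (μ := μ) measurable_snd.aemeasurable
  have hγ : 0 < ∫ z, hsicKernel k₁ k₂ z ∂(Measure.pi fun _ => μ) := by
    have h := hchar ν μ inferInstance inferInstance halt.symm
    rw [integral_hsicKernel hk₁meas hk₂meas hC₁ hC₂ μ ν hν]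
    linarith
  set γ := ∫ z, hsicKernel k₁ k₂ z ∂(Measure.pi fun _ => μ)
  have hsmall := tendsto_measure_vStatistic_le μ (measurable_hsicKernel hk₁meas hk₂meas)
    (abs_hsicKernel_le hC₁ hC₂) (half_lt_self hγ)
  have hp : ∀ ε : ℝ, 0 < ε →
      Tendsto (fun n : ℕ =>
          (Measure.pi fun _ : Fin n => μ)
            {D | ε ≤ (((Finset.univ.filter
                  (fun σ : Equiv.Perm (Fin n) =>
                    HSIC k₁ k₂ (permActPair σ D) ≥ HSIC k₁ k₂ D)).card : ℝ)
                / (n.factorial : ℝ))})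
        atTop (nhds 0) := by
    intro ε hε
    refine tendsto_of_tendsto_of_tendsto_of_le_of_le' tendsto_const_nhds hsmall
      (Eventually.of_forall fun _ => zero_le) ?_
    have hlim : Tendsto (fun n : ℕ => 8 * C₁ * C₂ / (n : ℝ)) atTop (nhds 0) :=
      tendsto_const_nhds.div_atTop tendsto_natCast_atTop_atTop
    filter_upwards [eventually_ne_atTop 0, hlim.eventually_lt_const (by positivity :
      0 < ε * (γ / 2))] with n hn hlt
    refine measure_mono fun D hD => ?_
    simp only [Set.mem_ofPred_eq] at hD ⊢
    rw [← HSIC_eq_vStatistic hn]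
    have hmarkov := pvalue_mul_HSIC_le hpsd₁ hpsd₂ hC₁ hC₂ hn D
    have hle := mul_le_mul_of_nonneg_right hD (HSIC_nonneg hpsd₁ hpsd₂ D)
    exact (lt_of_mul_lt_mul_left ((hle.trans hmarkov).trans_lt hlt) hε.le).le
  refine ⟨hp, fun α hα => ?_⟩
  have hlim := ENNReal.Tendsto.sub tendsto_const_nhds (hp α hα.1)
    (Or.inl ENNReal.one_ne_top)
  rw [tsub_zero] at hlim
  refine tendsto_of_tendsto_of_tendsto_of_le_of_le hlim tendsto_const_nhds (fun n => ?_)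
    fun n => prob_le_one
  rw [tsub_le_iff_right, ← measure_univ (μ := Measure.pi fun _ : Fin n => μ)]
  refine (measure_mono fun D _ => ?_).trans (measure_union_le _ _)
  exact le_total _ α
end
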